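/- arXiv:1908.01042 — 9 statements merged into one kernel-verified Lean document; each statement's English description precedes it below -/
import Mathlib

section
/- Let u be a solution (minimizer) of the problem F(u) = ∫_Ω f(∇u(x)) dx → inf over the class C_M, where f satisfies Condition (A), and let x₀ ∈ ∂Ω satisfy Condition (B). Then u(x₀) = 0. -/
noncomputable section

open MeasureTheory Set Filter
open scoped RealInnerProductSpace Topology

/-- The Euclidean plane. -/
abbrev E2 : Type := EuclideanSpace ℝ (Fin 2)

/-- A convex body in the plane: a compact convex set with nonempty interior. -/
def IsConvexBody (Ω : Set E2) : Prop :=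
  IsCompact Ω ∧ Convex ℝ Ω ∧ (interior Ω).Nonempty

/-- Condition (A): `(1+|x|)f(x)/(|y|f(y)) → +∞` as `(1+|x|)/|y| → 0`. -/
def CondA (f : E2 → ℝ) : Prop :=
  ∀ N : ℝ, 0 < N → ∃ δ : ℝ, 0 < δ ∧ ∀ x y : E2,
    1 + ‖x‖ < δ * ‖y‖ → N < ((1 + ‖x‖) * f x) / (‖y‖ * f y)

/-- `n` is an outward unit normal of a supporting line of `Ω` at `p`. -/
def IsSupportNormal (Ω : Set E2) (p n : E2) : Prop :=
  ‖n‖ = 1 ∧ ∀ x ∈ Ω, 0 ≤ ⟪p - x, n⟫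

/-- A boundary point is regular if the supporting line (equivalently, the outward
unit normal) at it is unique. -/
def RegularPt (Ω : Set E2) (p : E2) : Prop :=
  ∃! n : E2, IsSupportNormal Ω p n

/-- Condition (B) at `x₀`: `x₀` is a regular boundary point, and the endpoints
(extreme points) of the segment `l ∩ ∂Ω` are regular as well. -/
def CondB (Ω : Set E2) (x₀ : E2) : Prop :=
  RegularPt Ω x₀ ∧
  ∀ n : E2, IsSupportNormal Ω x₀ n →
    ∀ y ∈ ({x : E2 | ⟪x₀ - x, n⟫ = 0} ∩ frontier Ω).extremePoints ℝ,
      RegularPt Ω y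

/-- Volume of the image under the shrinking affine map. -/
lemma vol_affine_image (x₁ n e : E2) (a b S : ℝ) (ha : 0 < a) (s : Set E2) :
    volume ((fun x => x₁ + a • (x - x₁) + (b * (⟪x₁ - x, n⟫ + S)) • e) '' s)
      = ENNReal.ofReal |a * (a - b * ⟪e, n⟫)| * volume s := by
  let φ : Module.Dual ℝ E2 := (-(b / a)) • (innerₛₗ ℝ n)
  let A : E2 →ₗ[ℝ] E2 := a • LinearMap.transvection φ e
  have hA : ∀ y, A y = a • y - (b * ⟪y, n⟫) • e := by
    intro y
    simp only [A, φ, LinearMap.smul_apply, LinearMap.transvection.apply, innerₛₗ_apply_apply,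
      smul_add, smul_smul, smul_eq_mul]
    rw [sub_eq_add_neg, ← neg_smul, real_inner_comm n y]
    congr 2
    field_simp
  have hdet : LinearMap.det A = a * (a - b * ⟪e, n⟫) := by
    simp only [A, LinearMap.det_smul, LinearMap.transvection.det, φ, LinearMap.smul_apply,
      innerₛₗ_apply_apply, smul_eq_mul, real_inner_comm n e]
    rw [show Module.finrank ℝ E2 = 2 by simp]
    field_simp
    ring
  have himg : ((fun x => x₁ + a • (x - x₁) + (b * (⟪x₁ - x, n⟫ + S)) • e) '' s)
      = (fun y => (x₁ - a • x₁ + (b * (⟪x₁, n⟫ + S)) • e) + y) '' (A '' s) := by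
    rw [Set.image_image]
    congr 1
    funext x
    rw [hA, inner_sub_left]
    module
  rw [himg, Set.image_add_left, measure_preimage_add, Measure.addHaar_image_linearMap, hdet]

/-- Condition (A) makes `f` bounded. -/
lemma condA_bounded (f : E2 → ℝ) (hfpos : ∀ x, 0 < f x) (hfcont : Continuous f) (hA : CondA f) :
    ∃ C, ∀ x, f x ≤ C := by
  obtain ⟨δ, hδ, h⟩ := hA 1 one_pos
  obtain ⟨C, hC⟩ := (isCompact_closedBall (0 : E2) (2 / δ)).bddAbove_image hfcont.continuousOn
  refine ⟨max C (f 0 * δ), fun y => ?_⟩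
  by_cases hy : ‖y‖ ≤ 2 / δ
  · exact le_max_of_le_left (hC ⟨y, by simpa using hy, rfl⟩)
  · apply le_max_of_le_right
    push Not at hy
    rw [div_lt_iff₀ hδ] at hy
    have hy0 : 0 < ‖y‖ := by
      by_contra h0
      nlinarith
    have h1 := h 0 y (by simp; nlinarith)
    have hfy := hfpos y
    rw [lt_div_iff₀ (by positivity)] at h1
    simp at h1
    nlinarith [mul_pos hδ hfy]

lemma measurable_gradient' (u : E2 → ℝ) : Measurable (gradient u) := by
  unfold gradient
  exact (InnerProductSpace.toDual ℝ E2).symm.continuous.measurable.comp (measurable_fderiv ℝ u)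

lemma integrable_f_gradient {Ω : Set E2} (hΩ : IsCompact Ω) (f : E2 → ℝ) (hfpos : ∀ x, 0 < f x)
    (hfcont : Continuous f) (hA : CondA f) (u : E2 → ℝ) :
    IntegrableOn (fun x => f (gradient u x)) Ω := by
  obtain ⟨C, hC⟩ := condA_bounded f hfpos hfcont hA
  refine Measure.integrableOn_of_bounded (M := C) hΩ.measure_lt_top.ne
    (hfcont.measurable.comp (measurable_gradient' u)).aestronglyMeasurable ?_
  refine Eventually.of_forall fun x => ?_
  rw [Real.norm_of_nonneg (hfpos _).le]
  exact hC _

/-- Gradient bound for a concave function with small oscillation on a ball. -/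
lemma gradient_bound {Ω : Set E2} (u : E2 → ℝ) (hu : ConcaveOn ℝ Ω u) (y : E2) (d c m : ℝ)
    (hd : 0 < d) (hm : 0 ≤ m) (hb : Metric.ball y d ⊆ Ω) (hosc : ∀ z ∈ Metric.ball y d, |u z - c| ≤ m) :
    ‖gradient u y‖ ≤ 4 * m / d := by
  have h1 : ConcaveOn ℝ (Metric.ball y d) (fun z => u z - c) := by
    have := (hu.subset hb (convex_ball y d)).add_const (-c)
    simpa [sub_eq_add_neg] using! this
  have h2 := h1.lipschitzOnWith_of_abs_le (ε := d / 2) (M := m) (by positivity)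
    (fun a ha => hosc a ha)
  have h3 := norm_fderiv_le_of_lipschitzOn ℝ (x₀ := y) (Metric.ball_mem_nhds y (by linarith)) h2
  rw [fderiv_sub_const] at h3
  rw [gradient, LinearIsometryEquiv.norm_map]
  refine h3.trans (le_of_eq ?_)
  rw [Real.coe_toNNReal _ (by positivity)]
  field_simp
  ring

/-- Lower bound of `u` on contracted interiors. -/
lemma lower_bound {Ω : Set E2} (u : E2 → ℝ) (hu : ConcaveOn ℝ Ω u) (h0 : ∀ x ∈ Ω, 0 ≤ u x)
    (x₁ : E2) (L : ℝ) (xs : ℕ → E2) (hxs : ∀ j, xs j ∈ Ω) (hlim : Tendsto xs atTop (𝓝 x₁))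
    (cs : ℕ → ℝ)
    (hcs : Tendsto cs atTop (𝓝 L)) (hul : ∀ j, cs j ≤ u (xs j))
    (lam : ℝ) (hl0 : 0 < lam) (hl1 : lam < 1) (z : E2) (hz : z ∈ interior Ω) :
    (1 - lam) * L ≤ u ((1 - lam) • x₁ + lam • z) := by
  have ht : Tendsto (fun j => z + ((1 - lam) / lam) • (x₁ - xs j)) atTop (𝓝 z) := by
    have : Tendsto (fun j => z + ((1 - lam) / lam) • (x₁ - xs j)) atTop
        (𝓝 (z + ((1 - lam) / lam) • (x₁ - x₁))) :=
      tendsto_const_nhds.add ((tendsto_const_nhds.sub hlim).const_smul _)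
    simpa using this
  have hev := ht.eventually (isOpen_interior.mem_nhds hz)
  refine le_of_tendsto (hcs.const_mul (1 - lam)) ?_
  filter_upwards [hev] with j hj
  have hj' := interior_subset hj
  have hc := hu.2 (hxs j) hj' (by linarith : (0 : ℝ) ≤ 1 - lam) hl0.le (by ring)
  have he : (1 - lam) • xs j + lam • (z + ((1 - lam) / lam) • (x₁ - xs j))
      = (1 - lam) • x₁ + lam • z := by
    rw [smul_add, smul_smul, mul_div_cancel₀ _ hl0.ne']
    module
  rw [he] at hc
  simp only [smul_eq_mul] at hc
  nlinarith [hul j, mul_nonneg hl0.le (h0 _ hj'), mul_le_mul_of_nonneg_left (hul j) (by linarith : 0 ≤ 1 - lam)]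

/-- A boundary point of the face realizing the maximal limit value `L` of `u`. -/
lemma exists_max_point {Ω : Set E2} (hΩ : IsCompact Ω) (u : E2 → ℝ) (M : ℝ)
    (hub : ∀ x ∈ Ω, u x ∈ Icc 0 M) (x₀ n : E2) (hx₀ : x₀ ∈ Ω)
    (hn : ∀ x ∈ Ω, 0 ≤ ⟪x₀ - x, n⟫) :
    ∃ (L : ℝ) (x₁ : E2) (xs : ℕ → E2) (cs : ℕ → ℝ), u x₀ ≤ L ∧ x₁ ∈ Ω ∧ (∀ x, ⟪x₁ - x, n⟫ = ⟪x₀ - x, n⟫) ∧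
      (∀ j, xs j ∈ Ω) ∧ Tendsto xs atTop (𝓝 x₁) ∧ Tendsto cs atTop (𝓝 L) ∧
      (∀ j, cs j ≤ u (xs j)) ∧
      ∀ ε > 0, ∃ S > 0, ∀ x ∈ Ω, ⟪x₀ - x, n⟫ < S → u x ≤ L + ε := by
  set T : Set ℝ := {c | ∃ S > 0, ∀ x ∈ Ω, ⟪x₀ - x, n⟫ < S → u x ≤ c} with hT
  have hTne : T.Nonempty := ⟨M, 1, one_pos, fun x hx _ => (hub x hx).2⟩
  have hlb : u x₀ ∈ lowerBounds T := by
    rintro c ⟨S, hS, h⟩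
    exact h x₀ hx₀ (by simpa using hS)
  have hTb : BddBelow T := ⟨_, hlb⟩
  set L := sInf T with hL
  have hseq : ∀ j : ℕ, ∃ x ∈ Ω, ⟪x₀ - x, n⟫ < 1 / ((j : ℝ) + 1) ∧ L - 1 / ((j : ℝ) + 1) < u x := by
    intro j
    by_contra hcon
    push Not at hcon
    have hp : (0 : ℝ) < 1 / ((j : ℝ) + 1) := by positivity
    have : L - 1 / ((j : ℝ) + 1) ∈ T := ⟨_, hp, hcon⟩
    have := csInf_le hTb this
    linarith
  choose xs hxs hxh hxu using hseq
  obtain ⟨x₁, hx₁, φ, hφ, hlim⟩ := hΩ.tendsto_subseq hxs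
  have h0 : Tendsto (fun j : ℕ => 1 / ((j : ℝ) + 1)) atTop (𝓝 0) := tendsto_one_div_add_atTop_nhds_zero_nat
  have h0' := h0.comp hφ.tendsto_atTop
  have hz : ⟪x₀ - x₁, n⟫ = 0 := by
    apply le_antisymm _ (hn x₁ hx₁)
    have hc : Tendsto (fun j => ⟪x₀ - (xs ∘ φ) j, n⟫) atTop (𝓝 ⟪x₀ - x₁, n⟫) :=
      (tendsto_const_nhds.sub hlim).inner tendsto_const_nhds
    exact le_of_tendsto_of_tendsto' hc h0' fun j => (hxh (φ j)).le
  refine ⟨L, x₁, xs ∘ φ, fun j => L - 1 / ((φ j : ℝ) + 1), le_csInf hTne hlb, hx₁, ?_, fun j => hxs _, hlim, ?_,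
    fun j => (hxu _).le, ?_⟩
  · intro x
    have : x₁ - x = (x₀ - x) - (x₀ - x₁) := by abel
    rw [this, inner_sub_left, hz, sub_zero]
  · simpa using h0'.const_sub L
  · intro ε hε
    obtain ⟨c, ⟨S, hS, h⟩, hc⟩ := exists_lt_of_csInf_lt hTne (show sInf T < L + ε by linarith)
    exact ⟨S, hS, fun x hx hxS => (h x hx hxS).trans hc.le⟩

/-- Comparison of `u` with `min u (k h)`. -/
lemma cut_comparison {Ω : Set E2} (hΩ : IsCompact Ω) (hconv : Convex ℝ Ω) (M : ℝ)
    (f : E2 → ℝ) (hfpos : ∀ x, 0 < f x) (hfcont : Continuous f) (hA : CondA f)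
    (u : E2 → ℝ) (hu : ConcaveOn ℝ Ω u) (hub : ∀ x ∈ Ω, u x ∈ Icc 0 M)
    (hmin : ∀ v : E2 → ℝ, ConcaveOn ℝ Ω v → (∀ x ∈ Ω, v x ∈ Icc 0 M) →
      ∫ x in Ω, f (gradient u x) ≤ ∫ x in Ω, f (gradient v x))
    (x₁ n : E2) (hn : ∀ x ∈ Ω, 0 ≤ ⟪x₁ - x, n⟫) (k : ℝ) (hk : 0 < k)
    (hnull : volume {x | x ∈ interior Ω ∧ u x = k * ⟪x₁ - x, n⟫} = 0) :
    ∫ x in {x | x ∈ interior Ω ∧ k * ⟪x₁ - x, n⟫ < u x}, f (gradient u x) ≤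
      f (-(k • n)) * volume.real {x | x ∈ interior Ω ∧ k * ⟪x₁ - x, n⟫ < u x} := by
  set D := {x | x ∈ interior Ω ∧ k * ⟪x₁ - x, n⟫ < u x} with hD
  set g : E2 → ℝ := fun x => k * ⟪x₁ - x, n⟫ with hg
  have hgc : Continuous g := by fun_prop
  have huc := hu.continuousOn_interior
  have hDo : IsOpen D := by
    have := (huc.sub hgc.continuousOn).isOpen_inter_preimage isOpen_interior (isOpen_Ioi (a := (0 : ℝ)))
    have e : D = interior Ω ∩ (u - g) ⁻¹' Ioi 0 := by
      ext x
      simp [hD, hg]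
    rw [e]
    exact this
  have hDΩ : D ⊆ Ω := fun x hx => interior_subset hx.1
  have hggrad : ∀ x, gradient g x = -(k • n) := by
    intro x
    apply HasGradientAt.gradient
    rw [hasGradientAt_iff_hasFDerivAt]
    have h1 : HasFDerivAt (fun x => k * (⟪x₁, n⟫ - InnerProductSpace.toDual ℝ E2 n x))
        (k • (- (InnerProductSpace.toDual ℝ E2 n))) x :=
      (((InnerProductSpace.toDual ℝ E2 n).hasFDerivAt).const_sub _).const_mul k
    have e1 : g = (fun x => k * (⟪x₁, n⟫ - InnerProductSpace.toDual ℝ E2 n x)) := by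
      funext y
      simp [hg, inner_sub_left, real_inner_comm]
    have e2 : InnerProductSpace.toDual ℝ E2 (-(k • n)) = k • (- (InnerProductSpace.toDual ℝ E2 n)) := by
      ext y
      simp
    rw [e1, e2]
    exact h1
  have hgconc : ConcaveOn ℝ Ω g := by
    refine ⟨hconv, fun x _ y _ a b _ _ hab => le_of_eq ?_⟩
    simp only [hg, smul_eq_mul, inner_sub_left, inner_add_left, inner_smul_left]
    simp
    linear_combination (k * ⟪x₁, n⟫) * hab
  have hvconc : ConcaveOn ℝ Ω (u ⊓ g) := hu.inf hgconc
  have hvb : ∀ x ∈ Ω, (u ⊓ g) x ∈ Icc 0 M := fun x hx =>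
    ⟨le_min (hub x hx).1 (mul_nonneg hk.le (hn x hx)), (min_le_left _ _).trans (hub x hx).2⟩
  have hle := hmin _ hvconc hvb
  have hiu := integrable_f_gradient hΩ f hfpos hfcont hA u
  have hiv := integrable_f_gradient hΩ f hfpos hfcont hA (u ⊓ g)
  have hae : ∀ᵐ x ∂(volume.restrict Ω), f (gradient (u ⊓ g) x) =
      f (gradient u x) - D.indicator (fun x => f (gradient u x) - f (-(k • n))) x := by
    rw [ae_restrict_iff' hΩ.measurableSet]
    have hfr : ∀ᵐ x ∂(volume : Measure E2), x ∉ frontier Ω :=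
      measure_eq_zero_iff_ae_notMem.1 (hconv.addHaar_frontier volume)
    have hnu : ∀ᵐ x ∂(volume : Measure E2), x ∉ {x | x ∈ interior Ω ∧ u x = k * ⟪x₁ - x, n⟫} :=
      measure_eq_zero_iff_ae_notMem.1 hnull
    filter_upwards [hfr, hnu] with x hx1 hx2 hx
    have hxi : x ∈ interior Ω := by
      by_contra hcon
      exact hx1 ⟨subset_closure hx, hcon⟩
    have hne : u x ≠ g x := fun h => hx2 ⟨hxi, h⟩
    have hcu : ContinuousAt u x := huc.continuousAt (isOpen_interior.mem_nhds hxi)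
    rcases lt_or_gt_of_ne hne with hlt | hgt
    · have hxD : x ∉ D := fun h => absurd h.2 (not_lt.2 hlt.le)
      have heq : (u ⊓ g) =ᶠ[𝓝 x] u := by
        filter_upwards [hcu.eventually_lt hgc.continuousAt hlt] with y hy
        exact min_eq_left hy.le
      rw [Set.indicator_of_notMem hxD, sub_zero, gradient, gradient, heq.fderiv_eq]
    · have hxD : x ∈ D := ⟨hxi, hgt⟩
      have heq : (u ⊓ g) =ᶠ[𝓝 x] g := by
        filter_upwards [hgc.continuousAt.eventually_lt hcu hgt] with y hy
        exact min_eq_right hy.le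
      rw [Set.indicator_of_mem hxD, sub_sub_cancel, gradient, heq.fderiv_eq, ← hggrad x, gradient]
  have hiD : IntegrableOn (fun x => f (gradient u x)) D := hiu.mono_set hDΩ
  have hDfin : volume D ≠ ⊤ := ((measure_mono hDΩ).trans_lt hΩ.measure_lt_top).ne
  have hic : IntegrableOn (fun _ : E2 => f (-(k • n))) D := integrableOn_const hDfin
  have hiind : IntegrableOn (D.indicator (fun x => f (gradient u x) - f (-(k • n)))) Ω :=
    ((integrable_indicator_iff hDo.measurableSet).2 (hiD.sub hic)).integrableOn
  rw [integral_congr_ae hae, integral_sub hiu hiind, setIntegral_indicator hDo.measurableSet,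
    Set.inter_eq_self_of_subset_right hDΩ, integral_sub hiD hic, setIntegral_const] at hle
  simp only [smul_eq_mul] at hle
  linarith

lemma interior_height_pos {Ω : Set E2} (x₁ n : E2) (hn1 : ‖n‖ = 1)
    (hn : ∀ x ∈ Ω, 0 ≤ ⟪x₁ - x, n⟫) (p : E2) (hp : p ∈ interior Ω) : 0 < ⟪x₁ - p, n⟫ := by
  obtain ⟨r, hr, hb⟩ := Metric.isOpen_iff.1 isOpen_interior p hp
  have hm : p + (r / 2) • n ∈ Ω := by
    apply interior_subset
    apply hb
    rw [Metric.mem_ball, dist_eq_norm, add_sub_cancel_left, norm_smul, hn1, Real.norm_of_nonneg (by positivity)]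
    linarith
  have := hn _ hm
  rw [← sub_sub, inner_sub_left, inner_smul_left, real_inner_self_eq_norm_sq, hn1] at this
  simp at this
  linarith

lemma geom {Ω : Set E2} (hconv : Convex ℝ Ω) (x₁ p : E2) (r : ℝ) (hx₁ : x₁ ∈ Ω)
    (hb : Metric.ball p r ⊆ interior Ω) (lam σ : ℝ) (hl : 0 < lam) (hσ : 0 < σ) (hσ1 : 2 * σ ≤ 1)
    (x w : E2) (hx : x ∈ Ω) (hw : ‖w‖ < lam * σ * r) :
    ∃ z ∈ interior Ω, x₁ + (lam / 2) • (x - x₁) + (lam * σ) • (p - x₁) + w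
      = (1 - lam) • x₁ + lam • z := by
  have hls : 0 < lam * σ := by positivity
  have hp' : p + (lam * σ)⁻¹ • w ∈ interior Ω := by
    apply hb
    rw [Metric.mem_ball, dist_eq_norm, add_sub_cancel_left, norm_smul, Real.norm_of_nonneg (by positivity),
      inv_mul_lt_iff₀ hls]
    exact hw
  have hq := hconv.combo_self_interior_mem_interior hx₁ hp' (by linarith : 0 ≤ 1 - 2 * σ)
    (by linarith : 0 < 2 * σ) (by ring)
  have hz := hconv.combo_self_interior_mem_interior hx hq (by norm_num : (0 : ℝ) ≤ 1 / 2)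
    (by norm_num : (0 : ℝ) < 1 / 2) (by norm_num)
  refine ⟨_, hz, ?_⟩
  have e : (lam * σ) • ((lam * σ)⁻¹ • w) = w := by rw [smul_smul, mul_inv_cancel₀ hls.ne', one_smul]
  have e2 : lam • (1 / 2 : ℝ) • (2 * σ) • (lam * σ)⁻¹ • w = w := by
    nth_rewrite 2 [← e]
    module
  simp only [smul_add, e2]
  module

lemma exists_good_k {Ω : Set E2} (u : E2 → ℝ) (hu : ConcaveOn ℝ Ω u)
    (x₁ n : E2) (hn1 : ‖n‖ = 1) (hn : ∀ x ∈ Ω, 0 ≤ ⟪x₁ - x, n⟫) (k₀ : ℝ) :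
    ∃ k > k₀, volume {x | x ∈ interior Ω ∧ u x = k * ⟪x₁ - x, n⟫} = 0 := by
  have hpos := interior_height_pos x₁ n hn1 hn
  have hc : ContinuousOn (fun x => u x / ⟪x₁ - x, n⟫) (interior Ω) :=
    hu.continuousOn_interior.div (by fun_prop) fun x hx => (hpos x hx).ne'
  have hm : AEMeasurable (fun x => u x / ⟪x₁ - x, n⟫) (volume.restrict (interior Ω)) :=
    hc.aemeasurable isOpen_interior.measurableSet
  have hcount := Measure.countable_meas_level_set_pos₀ hm.nullMeasurable
  have hun : ¬ (Ioi k₀).Countable := by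
    intro h
    have h1 := Cardinal.mk_Ioi_real k₀
    have h2 := Cardinal.le_aleph0_iff_set_countable.2 h
    rw [h1] at h2
    exact absurd h2 (not_le.2 Cardinal.aleph0_lt_continuum)
  have : ∃ k ∈ Ioi k₀, k ∉ {t : ℝ | 0 < (volume.restrict (interior Ω)) {a | u a / ⟪x₁ - a, n⟫ = t}} := by
    by_contra hcon
    push Not at hcon
    exact hun (hcount.mono hcon)
  obtain ⟨k, hk, hk2⟩ := this
  refine ⟨k, hk, ?_⟩
  simp only [mem_ofPred_eq, not_lt, nonpos_iff_eq_zero] at hk2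
  rw [Measure.restrict_apply' isOpen_interior.measurableSet] at hk2
  refine measure_mono_null ?_ hk2
  rintro x ⟨hx, hx2⟩
  refine ⟨?_, hx⟩
  simp only [mem_ofPred_eq]
  rw [hx2, mul_div_cancel_right₀ _ (hpos x hx).ne']

set_option maxHeartbeats 2000000 in

/-- If `u` minimizes `F(u) = ∫_Ω f(∇u)` over the class of concave functions
`u : Ω → [0, M]`, `f` satisfies Condition (A), and `x₀ ∈ ∂Ω` satisfies
Condition (B), then `u(x₀) = 0`. -/
theorem boundary_value_zero_at_regular_point
    (Ω : Set E2) (hΩ : IsConvexBody Ω) (M : ℝ) (hM : 0 < M)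
    (f : E2 → ℝ) (hfpos : ∀ x, 0 < f x) (hfcont : Continuous f) (hA : CondA f)
    (u : E2 → ℝ) (hu : ConcaveOn ℝ Ω u) (hub : ∀ x ∈ Ω, u x ∈ Icc 0 M)
    (hmin : ∀ v : E2 → ℝ, ConcaveOn ℝ Ω v → (∀ x ∈ Ω, v x ∈ Icc 0 M) →
      ∫ x in Ω, f (gradient u x) ≤ ∫ x in Ω, f (gradient v x))
    (x₀ : E2) (hx₀ : x₀ ∈ frontier Ω) (hB : CondB Ω x₀) :
    u x₀ = 0 := by
  have hcpt := hΩ.1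
  have hconv := hΩ.2.1
  have hx₀Ω : x₀ ∈ Ω := hcpt.isClosed.frontier_subset hx₀
  by_contra hne
  have hu0 : 0 < u x₀ := lt_of_le_of_ne (hub x₀ hx₀Ω).1 (Ne.symm hne)
  obtain ⟨n, ⟨hn1, hn0⟩, -⟩ := hB.1
  obtain ⟨L, x₁, xs, cs, hLu, hx₁, hin, hxs, hxlim, hcslim, hcsu, hup⟩ :=
    exists_max_point hcpt u M hub x₀ n hx₀Ω hn0
  have hn : ∀ x ∈ Ω, 0 ≤ ⟪x₁ - x, n⟫ := fun x hx => by rw [hin]; exact hn0 x hx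
  simp only [← hin] at hup
  have hL : 0 < L := hu0.trans_le hLu
  have hlow := lower_bound u hu (fun x hx => (hub x hx).1) x₁ L xs hxs hxlim cs hcslim hcsu
  obtain ⟨p, hp⟩ := hΩ.2.2
  obtain ⟨r, hr, hball⟩ := Metric.isOpen_iff.1 isOpen_interior p hp
  have hP := interior_height_pos x₁ n hn1 hn p hp
  set P := ⟪x₁ - p, n⟫ with hPdef
  -- constants
  obtain ⟨ρ, hρdef⟩ : ∃ ρ, ρ = L / (16 * M) := ⟨_, rfl⟩
  have hρ : 0 < ρ := by rw [hρdef]; positivity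
  have hρM : ρ * M = L / 16 := by rw [hρdef]; field_simp
  obtain ⟨κ, hκdef⟩ : ∃ κ, κ = ρ * r / (2 * P) := ⟨_, rfl⟩
  have hκ : 0 < κ := by rw [hκdef]; positivity
  obtain ⟨C, hCdef⟩ : ∃ C, C = 1 + 4 * L / (κ * M) := ⟨_, rfl⟩
  have hC : 0 < C := by rw [hCdef]; positivity
  obtain ⟨δ, hδ, hAδ⟩ := hA (4 * C / ρ) (by positivity)
  obtain ⟨lam, hl0, hl1, hl2, hl3⟩ : ∃ lam > 0, lam ≤ 1 / 2 ∧ lam ≤ ρ ∧ C * lam < δ := by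
    refine ⟨min (1 / 2) (min ρ (δ / (2 * C))), by positivity, min_le_left _ _,
      (min_le_right _ _).trans (min_le_left _ _), ?_⟩
    have : min (1 / 2) (min ρ (δ / (2 * C))) ≤ δ / (2 * C) := (min_le_right _ _).trans (min_le_right _ _)
    calc C * min (1 / 2) (min ρ (δ / (2 * C))) ≤ C * (δ / (2 * C)) := by gcongr
      _ = δ / 2 := by field_simp
      _ < δ := by linarith
  obtain ⟨S₀, hS₀, hup⟩ := hup (lam * L) (by positivity)
  obtain ⟨k, hk0, hnull⟩ := exists_good_k u hu x₁ n hn1 hn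
    (max (1 / lam) (max (M * (3 * ρ + κ) / S₀) (4 * ρ * M / (lam * P))))
  simp only [gt_iff_lt, max_lt_iff] at hk0
  obtain ⟨hk1, hk2, hk3⟩ := hk0
  rw [div_lt_iff₀ (by positivity)] at hk1 hk2 hk3
  have hk : 0 < k := by
    by_contra hcon
    nlinarith
  obtain ⟨S, hSdef⟩ : ∃ S, S = M / k := ⟨_, rfl⟩
  have hS : 0 < S := by rw [hSdef]; positivity
  have hkS : k * S = M := by rw [hSdef]; field_simp
  have hS1 : S * (3 * ρ + κ) < S₀ := by
    rw [hSdef, div_mul_eq_mul_div, div_lt_iff₀ hk]; linarith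
  have hS2 : 4 * ρ * S < lam * P := by
    rw [hSdef, mul_div_assoc', div_lt_iff₀ hk]; linarith
  have hcut := cut_comparison hcpt hconv M f hfpos hfcont hA u hu hub hmin x₁ n hn k hk hnull
  set D := {x | x ∈ interior Ω ∧ k * ⟪x₁ - x, n⟫ < u x} with hD
  set K := {x | x ∈ Ω ∧ ⟪x₁ - x, n⟫ ≤ S} with hK
  have hKc : IsCompact K := hcpt.inter_right
    (isClosed_le (by fun_prop : Continuous fun x : E2 => ⟪x₁ - x, n⟫) continuous_const)
  set Φ : E2 → E2 := fun x => x₁ + (lam / 2) • (x - x₁) + (ρ / P * (⟪x₁ - x, n⟫ + S)) • (p - x₁) with hΦ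
  have hΦc : Continuous Φ := by fun_prop
  have hvol := vol_affine_image x₁ n (p - x₁) (lam / 2) (ρ / P) S (by positivity) K
  have hpn : ⟪p - x₁, n⟫ = -P := by rw [hPdef, ← inner_neg_left, neg_sub]
  have hdet : lam / 2 - ρ / P * ⟪p - x₁, n⟫ = lam / 2 + ρ := by rw [hpn]; field_simp; ring
  rw [hdet] at hvol
  -- heights
  have hheight : ∀ x, ⟪x₁ - Φ x, n⟫ = (lam / 2 + ρ) * ⟪x₁ - x, n⟫ + ρ * S := by
    intro x
    have : x₁ - Φ x = (lam / 2) • (x₁ - x) - (ρ / P * (⟪x₁ - x, n⟫ + S)) • (p - x₁) := by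
      simp only [hΦ]; module
    rw [this, inner_sub_left, inner_smul_left, inner_smul_left, hpn]
    simp
    field_simp
    ring
  -- neighbourhoods of image points
  have hnb : ∀ x ∈ K, ∀ w : E2, ‖w‖ < κ * S → Φ x + w ∈ interior Ω ∧ |u (Φ x + w) - L| ≤ lam * L ∧
      (1 - lam) * L ≤ u (Φ x + w) := by
    rintro x ⟨hx, hxS⟩ w hw
    have hx0 := hn x hx
    set t := ⟪x₁ - x, n⟫ with ht
    have hσe : lam * (ρ * (t + S) / (lam * P)) = ρ / P * (t + S) := by field_simp
    have hw' : ‖w‖ < lam * (ρ * (t + S) / (lam * P)) * r := by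
      refine hw.trans_le ?_
      rw [hσe, hκdef]
      have h1 : ρ * r / (2 * P) * S = ρ / P * (S / 2) * r := by field_simp
      rw [h1]
      gcongr
      linarith
    have hσ1 : 2 * (ρ * (t + S) / (lam * P)) ≤ 1 := by
      rw [mul_div_assoc', div_le_one (by positivity)]
      nlinarith
    obtain ⟨z, hz, hez⟩ := geom hconv x₁ p r hx₁ hball lam (ρ * (t + S) / (lam * P)) hl0 (by positivity) hσ1
      x w hx hw'
    rw [hσe] at hez
    have hez' : Φ x + w = (1 - lam) • x₁ + lam • z := hez
    have hmem : Φ x + w ∈ interior Ω := by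
      rw [hez']
      exact hconv.combo_self_interior_mem_interior hx₁ hz (by linarith) hl0 (by ring)
    have hlo : (1 - lam) * L ≤ u (Φ x + w) := by
      rw [hez']
      exact hlow lam hl0 (by linarith) z hz
    have hhi : u (Φ x + w) ≤ L + lam * L := by
      apply hup _ (interior_subset hmem)
      rw [← sub_sub, inner_sub_left, hheight x]
      have hwn : -⟪w, n⟫ ≤ ‖w‖ := by
        have := abs_real_inner_le_norm w n
        rw [hn1, mul_one] at this
        exact (neg_le_abs _).trans this
      have h1 : (lam / 2 + ρ) * t ≤ (2 * ρ) * S := by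
        apply mul_le_mul _ hxS hx0 (by positivity)
        linarith
      rw [← ht]
      linarith
    refine ⟨hmem, ?_, hlo⟩
    rw [abs_le]
    constructor <;> linarith
  have hGD : Φ '' K ⊆ D := by
    rintro _ ⟨x, hx, rfl⟩
    have h := hnb x hx 0 (by simp; positivity)
    rw [add_zero] at h
    refine ⟨h.1, lt_of_lt_of_le ?_ h.2.2⟩
    rw [hheight x]
    have h1 : (lam / 2 + ρ) * ⟪x₁ - x, n⟫ ≤ (2 * ρ) * S := by
      apply mul_le_mul _ hx.2 (hn x hx.1) (by positivity)
      linarith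
    calc k * ((lam / 2 + ρ) * ⟪x₁ - x, n⟫ + ρ * S) ≤ k * ((2 * ρ) * S + ρ * S) := by gcongr
      _ = 3 * ρ * (k * S) := by ring
      _ = 3 * (ρ * M) := by rw [hkS]; ring
      _ < (1 - lam) * L := by rw [hρM]; nlinarith
  have hlt : ∀ x ∈ D, ⟪x₁ - x, n⟫ < S := by
    rintro x ⟨hx, hxu⟩
    have := (hub x (interior_subset hx)).2
    rw [hSdef, lt_div_iff₀ hk]
    linarith
  have hDK : D ⊆ K := fun x hx => ⟨interior_subset hx.1, (hlt x hx).le⟩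
  have hDΩ : D ⊆ Ω := fun x hx => interior_subset hx.1
  -- positive volume
  have hKpos : 0 < volume.real K := by
    rw [Measure.real, ENNReal.toReal_pos_iff]
    refine ⟨?_, hKc.measure_lt_top⟩
    have hopen : IsOpen (interior Ω ∩ {x | ⟪x₁ - x, n⟫ < S}) :=
      isOpen_interior.inter (isOpen_lt (by fun_prop) continuous_const)
    have hx₁K : x₁ ∈ K := ⟨hx₁, by simpa using hS.le⟩
    have hy := hGD ⟨x₁, hx₁K, rfl⟩
    refine (hopen.measure_pos volume ⟨_, hy.1, hlt _ hy⟩).trans_le (measure_mono ?_)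
    rintro x ⟨hx, hxS⟩
    exact ⟨interior_subset hx, le_of_lt hxS⟩
  have hvolr : volume.real (Φ '' K) = (lam / 2 * (lam / 2 + ρ)) * volume.real K := by
    rw [Measure.real, hvol, ENNReal.toReal_mul, ENNReal.toReal_ofReal (abs_nonneg _),
      abs_of_pos (by positivity), Measure.real]
  have hcpos := hfpos (-(k • n))
  set c := f (-(k • n)) with hc
  have hnk : ‖-(k • n)‖ = k := by rw [norm_neg, norm_smul, hn1, mul_one, Real.norm_of_nonneg hk.le]
  -- pointwise bound
  have hpt : ∀ y ∈ Φ '' K, 4 / (ρ * lam) * c ≤ f (gradient u y) := by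
    rintro _ ⟨x, hx, rfl⟩
    have hb : ∀ z ∈ Metric.ball (Φ x) (κ * S), z ∈ interior Ω ∧ |u z - L| ≤ lam * L := by
      intro z hz
      rw [Metric.mem_ball, dist_eq_norm] at hz
      have := hnb x hx (z - Φ x) hz
      rw [add_sub_cancel] at this
      exact ⟨this.1, this.2.1⟩
    have hg := gradient_bound u hu (Φ x) (κ * S) L (lam * L) (by positivity) (by positivity)
      (fun z hz => interior_subset (hb z hz).1) (fun z hz => (hb z hz).2)
    set G := gradient u (Φ x)
    have hg2 : 1 + ‖G‖ ≤ C * lam * k := by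
      have e : 4 * (lam * L) / (κ * S) = 4 * L / (κ * M) * (lam * k) := by
        rw [← hkS]; field_simp
      rw [e] at hg
      rw [hCdef]
      nlinarith
    have h1 := hAδ G (-(k • n)) (by rw [hnk]; nlinarith)
    rw [hnk, ← hc, lt_div_iff₀ (by positivity)] at h1
    have hfG := hfpos G
    have h2 : (1 + ‖G‖) * f G ≤ C * lam * k * f G := by gcongr
    have h3 : 4 * C / ρ * (k * c) < C * lam * k * f G := h1.trans_le h2
    have h4 : 4 * C / ρ * (k * c) = C * lam * k * (4 / (ρ * lam) * c) := by field_simp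
    rw [h4] at h3
    exact (lt_of_mul_lt_mul_left h3 (by positivity)).le
  have hiu := integrable_f_gradient hcpt f hfpos hfcont hA u
  have hGc : IsCompact (Φ '' K) := hKc.image hΦc
  have hI1 : 4 / (ρ * lam) * c * volume.real (Φ '' K) ≤ ∫ x in Φ '' K, f (gradient u x) :=
    setIntegral_ge_of_const_le_real hGc.measurableSet hGc.measure_lt_top.ne hpt
      (hiu.mono_set (hGD.trans hDΩ))
  have hI2 : ∫ x in Φ '' K, f (gradient u x) ≤ ∫ x in D, f (gradient u x) :=
    setIntegral_mono_set (hiu.mono_set hDΩ) (Eventually.of_forall fun x => (hfpos _).le)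
      hGD.eventuallyLE
  have hDr : volume.real D ≤ volume.real K := measureReal_mono hDK hKc.measure_lt_top.ne
  have hfin : 4 / (ρ * lam) * c * volume.real (Φ '' K) ≤ c * volume.real K :=
    (hI1.trans (hI2.trans hcut)).trans (by gcongr)
  rw [hvolr] at hfin
  have e : 4 / (ρ * lam) * c * (lam / 2 * (lam / 2 + ρ) * volume.real K)
      = (2 + lam / ρ) * (c * volume.real K) := by field_simp; ring
  rw [e] at hfin
  have hcK : 0 < c * volume.real K := by positivity
  have : 0 < lam / ρ := by positivity
  nlinarith
end
end

section
/- Let u be a solution (minimizer) of the problem F(u) = ∫_Ω f(∇u(x)) dx → inf over the class C_M, where f satisfies Condition (A) and all points of ∂Ω are regular. Then u(x) = 0 for every x ∈ ∂Ω. -/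
noncomputable section

open MeasureTheory Set Filter
open scoped RealInnerProductSpace Topology

lemma exists_tau (n : E2) (hn : ‖n‖ = 1) : ∃ τ : E2, ‖τ‖ = 1 ∧ ⟪τ, n⟫ = 0 ∧
    ∀ w : E2, w = ⟪w, τ⟫ • τ + ⟪w, n⟫ • n := by
  have h1 : n 0 ^ 2 + n 1 ^ 2 = 1 := by
    have := EuclideanSpace.real_norm_sq_eq n
    rw [hn, Fin.sum_univ_two] at this
    linarith
  refine ⟨!₂[-n 1, n 0], ?_, ?_, ?_⟩
  · rw [EuclideanSpace.norm_eq, Fin.sum_univ_two]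
    simp
    linarith
  · simp [PiLp.inner_apply, Fin.sum_univ_two]
    ring
  · intro w
    ext i
    fin_cases i
    · simp [PiLp.inner_apply, Fin.sum_univ_two]
      linear_combination (-w 0) * h1
    · simp [PiLp.inner_apply, Fin.sum_univ_two]
      linear_combination (-w 1) * h1

lemma convex3 {S : Set E2} (hS : Convex ℝ S) {x y z : E2} (hx : x ∈ S) (hy : y ∈ S) (hz : z ∈ S)
    {a b c : ℝ} (ha : 0 ≤ a) (hb : 0 ≤ b) (hc : 0 ≤ c) (h : a + b + c = 1) :
    a • x + b • y + c • z ∈ S := by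
  have := hS.sum_mem (t := Finset.univ) (w := ![a, b, c]) (z := ![x, y, z])
    (by intro i _; fin_cases i <;> simpa) (by simp [Fin.sum_univ_three, h])
    (by intro i _; fin_cases i <;> simpa)
  simpa [Fin.sum_univ_three] using this

lemma dir_mem {Ω : Set E2} (hΩ : IsConvexBody Ω) {p n : E2} (hp : p ∈ Ω)
    (huniq : ∀ n', IsSupportNormal Ω p n' → n' = n) {d : E2} (hd : ⟪d, n⟫ < 0) :
    ∃ r : ℝ, 0 < r ∧ p + r • d ∈ interior Ω := by
  obtain ⟨hc, hconv, hne⟩ := hΩ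
  by_contra hcon
  push Not at hcon
  have hclos : closure (interior Ω) = Ω := by
    rw [hconv.closure_interior_eq_closure_of_nonempty_interior hne, hc.isClosed.closure_eq]
  let R : Set E2 := (fun r : ℝ => p + r • d) '' Ioi 0
  have hR : Convex ℝ R := by
    rintro _ ⟨a, ha, rfl⟩ _ ⟨b, hb, rfl⟩ s t hs ht hst
    refine ⟨s * a + t * b, ?_, ?_⟩
    · exact (convex_Ioi (0:ℝ)) ha hb hs ht hst
    · have : s = 1 - t := by linarith
      subst this
      module
  have hdisj : Disjoint (interior Ω) R := by
    rw [Set.disjoint_left]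
    rintro _ hx ⟨r, hr, rfl⟩
    exact hcon r hr hx
  obtain ⟨φ, c, h1, h2⟩ := geometric_hahn_banach_open hconv.interior isOpen_interior hR hdisj
  have h3 : ∀ x ∈ Ω, φ x ≤ c := by
    intro x hx
    rw [← hclos] at hx
    have : IsClosed {x | φ x ≤ c} := isClosed_le φ.continuous continuous_const
    exact (closure_minimal (fun y hy => (h1 y hy).le) this) hx
  have h4 : ∀ r : ℝ, 0 < r → c ≤ φ p + r * φ d := by
    intro r hr
    have := h2 _ ⟨r, hr, rfl⟩
    simpa using this
  have h5 : φ p = c := by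
    apply le_antisymm (h3 p hp)
    by_contra hlt
    push Not at hlt
    have hpos : 0 < (c - φ p) / (2 * (|φ d| + 1)) := by
      apply div_pos <;> [linarith; positivity]
    have := h4 _ hpos
    have h6 : (c - φ p) / (2 * (|φ d| + 1)) * φ d ≤ (c - φ p) / (2 * (|φ d| + 1)) * (|φ d| + 1) := by
      gcongr
      linarith [le_abs_self (φ d)]
    have h7 : (c - φ p) / (2 * (|φ d| + 1)) * (|φ d| + 1) = (c - φ p) / 2 := by
      field_simp
    linarith
  have h6 : 0 ≤ φ d := by
    have := h4 1 one_pos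
    linarith
  obtain ⟨m, hm⟩ : ∃ m : E2, ∀ x, φ x = ⟪x, m⟫ := by
    refine ⟨(InnerProductSpace.toDual ℝ E2).symm φ, fun x => ?_⟩
    rw [real_inner_comm, InnerProductSpace.toDual_symm_apply]
  have hm0 : m ≠ 0 := by
    rintro rfl
    obtain ⟨q, hq⟩ := hne
    have := h1 q hq
    rw [← h5, hm, hm] at this
    simp at this
  have hmn : 0 < ‖m‖ := norm_pos_iff.mpr hm0
  have hs : IsSupportNormal Ω p (‖m‖⁻¹ • m) := by
    refine ⟨by rw [norm_smul, norm_inv, norm_norm]; field_simp, fun x hx => ?_⟩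
    rw [inner_smul_right, inner_sub_left, ← hm, ← hm, h5]
    have := h3 x hx
    have : 0 ≤ c - φ x := by linarith
    positivity
  have := huniq _ hs
  rw [← this, inner_smul_right, ← hm] at hd
  have : 0 ≤ ‖m‖⁻¹ * φ d := by positivity
  linarith

lemma wedge_mem {Ω : Set E2} (hΩ : IsConvexBody Ω) {p n τ : E2} (hp : p ∈ Ω) (hn : ‖n‖ = 1)
    (hτ : ⟪τ, n⟫ = 0)
    (huniq : ∀ n', IsSupportNormal Ω p n' → n' = n) {η : ℝ} (hη : 0 < η) :
    ∃ ρ : ℝ, 0 < ρ ∧ ∀ t h : ℝ, η * |t| ≤ h → h ≤ ρ → p + t • τ - h • n ∈ Ω := by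
  have hnn : ⟪n, n⟫ = 1 := by rw [real_inner_self_eq_norm_sq, hn]; norm_num
  obtain ⟨r1, hr1, h1⟩ := dir_mem hΩ hp huniq (d := τ - η • n)
    (by rw [inner_sub_left, hτ, inner_smul_left, hnn]; simpa using hη)
  obtain ⟨r2, hr2, h2⟩ := dir_mem hΩ hp huniq (d := -τ - η • n)
    (by rw [inner_sub_left, inner_neg_left, hτ, inner_smul_left, hnn]; simpa using hη)
  replace h1 := interior_subset h1
  replace h2 := interior_subset h2
  refine ⟨η * min r1 r2, by positivity, fun t h hth hh => ?_⟩
  set r := min r1 r2 with hr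
  have hrr1 : r ≤ r1 := min_le_left _ _
  have hrr2 : r ≤ r2 := min_le_right _ _
  have habs := abs_le.mp (show |t| ≤ h / η by rw [le_div_iff₀ hη]; linarith)
  have hhr : h / η ≤ r := by rw [div_le_iff₀ hη]; linarith
  have ha : 0 ≤ (h / η + t) / 2 := by linarith
  have hb : 0 ≤ (h / η - t) / 2 := by linarith
  have hA : (h / η + t) / 2 / r1 ≤ (h / η + t) / 2 / r := by gcongr
  have hB : (h / η - t) / 2 / r2 ≤ (h / η - t) / 2 / r := by gcongr
  have hrpos : 0 < r := lt_min hr1 hr2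
  have hsum : (h / η + t) / 2 / r + (h / η - t) / 2 / r ≤ 1 := by
    rw [← add_div, div_le_one hrpos]; linarith
  have := convex3 hΩ.2.1 h1 h2 hp (a := (h / η + t) / 2 / r1) (b := (h / η - t) / 2 / r2)
    (c := 1 - (h / η + t) / 2 / r1 - (h / η - t) / 2 / r2) (by positivity) (by positivity)
    (by linarith) (by ring)
  convert this using 1
  have e1 : (h / η + t) / 2 / r1 * r1 = (h / η + t) / 2 := by field_simp
  have e2 : (h / η - t) / 2 / r2 * r2 = (h / η - t) / 2 := by field_simp
  have e3 : h / η * η = h := by field_simp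
  generalize (h / η + t) / 2 / r1 = A at *
  generalize (h / η - t) / 2 / r2 = B at *
  generalize h / η = q at *
  subst e3
  have e4 : A • (p + r1 • (τ - η • n)) + B • (p + r2 • (-τ - η • n)) + (1 - A - B) • p
     = p + (A * r1) • (τ - η • n) + (B * r2) • (-τ - η • n) := by module
  rw [e4, e1, e2]
  module

lemma grad_ineq {Ω : Set E2} {u : E2 → ℝ} (hu : ConcaveOn ℝ Ω u) {x y : E2} (hx : x ∈ Ω)
    (hy : y ∈ Ω) (hd : DifferentiableAt ℝ u x) : u y - u x ≤ ⟪gradient u x, y - x⟫ := by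
  have h1 : HasDerivAt (fun s : ℝ => u (x + s • (y - x))) (⟪gradient u x, y - x⟫) 0 := by
    have hg := hd.hasGradientAt.hasFDerivAt
    have hl : HasDerivAt (fun s : ℝ => x + s • (y - x)) (y - x) 0 := by
      simpa using ((hasDerivAt_id (0:ℝ)).smul_const (y - x)).const_add x
    have hg' : HasFDerivAt u (InnerProductSpace.toDual ℝ E2 (gradient u x)) (x + (0:ℝ) • (y - x)) := by
      simpa using hg
    have h := hg'.comp_hasDerivAt (0:ℝ) hl
    rw [InnerProductSpace.toDual_apply_apply] at h
    exact h
  have h2 := h1.tendsto_slope_zero_right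
  refine ge_of_tendsto h2 ?_
  have : Ioo (0:ℝ) 1 ∈ 𝓝[>] (0:ℝ) := Ioo_mem_nhdsGT one_pos
  filter_upwards [this] with s hs
  have hc := hu.2 hx hy (show 0 ≤ 1 - s by linarith [hs.2]) hs.1.le (by ring)
  have e : (1 - s) • x + s • y = x + s • (y - x) := by module
  rw [e] at hc
  simp only [smul_eq_mul, zero_add, zero_smul, add_zero] at hc ⊢
  rw [inv_mul_eq_div, le_div_iff₀ hs.1]
  nlinarith

lemma pick_point {Ω : Set E2} (hc : IsCompact Ω) {p₀ n : E2} (hp₀ : p₀ ∈ Ω)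
    (hn : IsSupportNormal Ω p₀ n) {u : E2 → ℝ} {M : ℝ} (hub : ∀ x ∈ Ω, u x ∈ Icc 0 M) :
    ∃ (L : ℝ) (p : E2), u p₀ ≤ L ∧ p ∈ Ω ∧ ⟪p₀ - p, n⟫ = 0 ∧
      (∀ ε : ℝ, 0 < ε → ∃ ρ : ℝ, 0 < ρ ∧ ∀ x ∈ Ω, ⟪p - x, n⟫ < ρ → u x ≤ L + ε) ∧
      ∃ (y : ℕ → E2) (c : ℕ → ℝ), (∀ j, y j ∈ Ω) ∧ Tendsto y atTop (𝓝 p) ∧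
        Tendsto c atTop (𝓝 L) ∧ ∀ j, c j ≤ u (y j) := by
  let S : Set ℝ := {c | ∃ ρ : ℝ, 0 < ρ ∧ ∀ x ∈ Ω, ⟪p₀ - x, n⟫ < ρ → u x ≤ c}
  have hlow : ∀ c ∈ S, u p₀ ≤ c := by
    rintro c ⟨ρ, hρ, h⟩
    exact h p₀ hp₀ (by simpa using hρ)
  have hSne : S.Nonempty := ⟨M, 1, one_pos, fun x hx _ => (hub x hx).2⟩
  have hSb : BddBelow S := ⟨u p₀, hlow⟩
  set L := sInf S with hL
  have hseq : ∀ j : ℕ, ∃ y ∈ Ω, ⟪p₀ - y, n⟫ < 1 / ((j : ℝ) + 1) ∧ L - 1 / ((j : ℝ) + 1) < u y := by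
    intro j
    have hj : (0 : ℝ) < 1 / ((j : ℝ) + 1) := by positivity
    by_contra hcon
    push Not at hcon
    have : L - 1 / ((j : ℝ) + 1) ∈ S := ⟨_, hj, fun x hx h => hcon x hx h⟩
    have := csInf_le hSb this
    linarith
  choose y hy hy1 hy2 using hseq
  obtain ⟨p, hp, φ, hφ, hlim⟩ := hc.tendsto_subseq hy
  have h0 : Tendsto (fun j : ℕ => 1 / (((φ j : ℕ) : ℝ) + 1)) atTop (𝓝 0) :=
    tendsto_one_div_add_atTop_nhds_zero_nat.comp hφ.tendsto_atTop
  have hp0 : ⟪p₀ - p, n⟫ = 0 := by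
    apply le_antisymm _ (hn.2 p hp)
    have h1 : Tendsto (fun j => ⟪p₀ - y (φ j), n⟫) atTop (𝓝 ⟪p₀ - p, n⟫) :=
      (tendsto_const_nhds.sub hlim).inner tendsto_const_nhds
    exact le_of_tendsto_of_tendsto' h1 h0 (fun j => (hy1 (φ j)).le)
  refine ⟨L, p, le_csInf hSne hlow, hp, hp0, ?_, fun j => y (φ j),
    fun j => L - 1 / (((φ j : ℕ) : ℝ) + 1), fun j => hy _, hlim, ?_, fun j => (hy2 _).le⟩
  · intro ε hε
    obtain ⟨c, ⟨ρ, hρ, h⟩, hcL⟩ := exists_lt_of_csInf_lt hSne (show sInf S < L + ε by linarith)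
    refine ⟨ρ, hρ, fun x hx hxρ => (h x hx ?_).trans hcL.le⟩
    have : ⟪p₀ - x, n⟫ = ⟪p₀ - p, n⟫ + ⟪p - x, n⟫ := by
      rw [← inner_add_left]; congr 1; abel
    rw [this, hp0, zero_add]; exact hxρ
  · simpa using tendsto_const_nhds.sub h0

lemma lower_near {Ω : Set E2} (hΩ : IsConvexBody Ω) {p n : E2} (hp : p ∈ Ω) (hn : ‖n‖ = 1)
    (huniq : ∀ n', IsSupportNormal Ω p n' → n' = n) {u : E2 → ℝ} (hu : ConcaveOn ℝ Ω u)
    (hu0 : ∀ x ∈ Ω, 0 ≤ u x)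
    {L : ℝ} (hL : 0 < L) {y : ℕ → E2} {c : ℕ → ℝ} (hy : ∀ j, y j ∈ Ω)
    (hyp : Tendsto y atTop (𝓝 p)) (hcL : Tendsto c atTop (𝓝 L)) (hcu : ∀ j, c j ≤ u (y j)) :
    ∃ r₁ : ℝ, 0 < r₁ ∧ ∀ r : ℝ, 0 < r → r ≤ r₁ → p - r • n ∈ interior Ω ∧ L / 4 < u (p - r • n) := by
  have hnn : ⟪n, n⟫ = 1 := by rw [real_inner_self_eq_norm_sq, hn]; norm_num
  obtain ⟨r0, hr0, h0⟩ := dir_mem hΩ hp huniq (d := -n) (by rw [inner_neg_left, hnn]; norm_num)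
  refine ⟨r0 / 2, by positivity, fun r hr hr1 => ?_⟩
  have hl : r / r0 ≤ 1 / 2 := by rw [div_le_iff₀ hr0]; linarith
  have hl0 : 0 < r / r0 := by positivity
  have hlr : r / r0 * r0 = r := by field_simp
  generalize r / r0 = l at *
  have e : (1 - l) • p + l • (p + r0 • (-n)) = p - r • n := by
    rw [← hlr]; module
  have hint : p - r • n ∈ interior Ω := by
    rw [← e]
    exact hΩ.2.1.combo_self_interior_mem_interior hp h0 (by linarith) hl0 (by ring)
  refine ⟨hint, ?_⟩
  have hcont : ContinuousAt u (p - r • n) :=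
    hu.continuousOn_interior.continuousAt (isOpen_interior.mem_nhds hint)
  have hq : Tendsto (fun j => (1 - l) • y j + l • (p + r0 • (-n))) atTop (𝓝 (p - r • n)) := by
    rw [← e]
    exact (hyp.const_smul _).add tendsto_const_nhds
  have h1 := hcont.tendsto.comp hq
  have h2 : Tendsto (fun j => (1 - l) * c j) atTop (𝓝 ((1 - l) * L)) := hcL.const_mul _
  have h3 : (1 - l) * L ≤ u (p - r • n) := by
    refine le_of_tendsto_of_tendsto' h2 h1 (fun j => ?_)
    have := hu.2 (hy j) (interior_subset h0) (show 0 ≤ 1 - l by linarith) hl0.le (by ring)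
    have h4 := hu0 _ (interior_subset h0)
    have h5 := hcu j
    simp only [smul_eq_mul, Function.comp] at this ⊢
    have h6 : (1 - l) * c j ≤ (1 - l) * u (y j) := by gcongr; linarith
    have h7 : 0 ≤ l * u (p + r0 • -n) := by positivity
    linarith
  nlinarith

lemma interior_pos_nonempty {Ω : Set E2} {w : E2 → ℝ}
    (hw : ConcaveOn ℝ Ω w) {e : E2} (he : e ∈ interior Ω) (hwe : 0 < w e) :
    (interior {x ∈ Ω | 0 < w x}).Nonempty := by
  refine ⟨e, mem_interior_iff_mem_nhds.mpr ?_⟩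
  have hcont : ContinuousAt w e :=
    hw.continuousOn_interior.continuousAt (isOpen_interior.mem_nhds he)
  filter_upwards [mem_interior_iff_mem_nhds.mp he, hcont.eventually_const_lt hwe] with x hx hx2
  exact ⟨hx, hx2⟩

lemma concave_sub_lin {Ω : Set E2} {u : E2 → ℝ} (hu : ConcaveOn ℝ Ω u) (k : ℝ) (p n : E2) :
    ConcaveOn ℝ Ω (fun x => u x - k * ⟪p - x, n⟫) := by
  refine ⟨hu.1, fun x hx y hy a b ha hb hab => ?_⟩
  have h := hu.2 hx hy ha hb hab
  have hb' : a = 1 - b := by linarith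
  subst hb'
  simp only [smul_eq_mul, inner_sub_left, inner_add_left, inner_smul_left, RCLike.conj_to_real] at h ⊢
  linarith

lemma concave_lin {Ω : Set E2} (hΩ : Convex ℝ Ω) (k : ℝ) (p n : E2) :
    ConcaveOn ℝ Ω (fun x => k * ⟪p - x, n⟫) := by
  refine ⟨hΩ, fun x hx y hy a b ha hb hab => ?_⟩
  have hb' : a = 1 - b := by linarith
  subst hb'
  simp only [smul_eq_mul, inner_sub_left, inner_add_left, inner_smul_left, RCLike.conj_to_real]
  linarith

/-- squeeze map -/
def sqz (n : E2) (a b : ℝ) : E2 →ₗ[ℝ] E2 where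
  toFun w := a • w + ((b - a) * ⟪w, n⟫) • n
  map_add' x y := by rw [inner_add_left]; module
  map_smul' c x := by
    simp only [inner_smul_left, RCLike.conj_to_real, RingHom.id_apply]; module

lemma det_sqz (n : E2) (hn : ‖n‖ = 1) (a b : ℝ) : LinearMap.det (sqz n a b) = a * b := by
  have h1 : n 0 ^ 2 + n 1 ^ 2 = 1 := by
    have := EuclideanSpace.real_norm_sq_eq n
    rw [hn, Fin.sum_univ_two] at this
    linarith
  rw [← LinearMap.det_toMatrix (EuclideanSpace.basisFun (Fin 2) ℝ).toBasis, Matrix.det_fin_two]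
  simp [LinearMap.toMatrix_apply, sqz, PiLp.inner_apply, Fin.sum_univ_two]
  linear_combination (a * (b - a)) * h1

set_option maxHeartbeats 2000000 in
lemma core {Ω : Set E2} (hΩ : IsConvexBody Ω) {p n τ : E2} (hn : ‖n‖ = 1)
    (hτ1 : ‖τ‖ = 1) (hτ : ⟪τ, n⟫ = 0) (hdec : ∀ w : E2, w = ⟪w, τ⟫ • τ + ⟪w, n⟫ • n)
    (hs : ∀ x ∈ Ω, 0 ≤ ⟪p - x, n⟫)
    {u : E2 → ℝ} (hu : ConcaveOn ℝ Ω u) {M m r₁ : ℝ} (hM : 0 < M)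
    (hub : ∀ x ∈ Ω, u x ∈ Icc 0 M) (hm : 0 < m) (hmM : m ≤ M) (hr₁ : 0 < r₁)
    (hlow : ∀ r : ℝ, 0 < r → r ≤ r₁ → p - r • n ∈ interior Ω ∧ m < u (p - r • n))
    (hgrad : ∀ ε : ℝ, 0 < ε → ∃ ρ : ℝ, 0 < ρ ∧ ∀ x ∈ Ω, ⟪p - x, n⟫ < ρ →
      ∀ g : E2, (∀ y ∈ Ω, u y - u x ≤ ⟪g, y - x⟫) → -ε ≤ ⟪g, p - x⟫)
    (hwedge : ∀ η : ℝ, 0 < η → ∃ ρ : ℝ, 0 < ρ ∧ ∀ t h : ℝ, η * |t| ≤ h → h ≤ ρ →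
      p + t • τ - h • n ∈ Ω) (δ : ℝ) (hδ : 0 < δ) (hδ2 : δ ≤ 1 / 2) :
    ∃ k : ℝ, 0 < k ∧ 1 < (4 + 6 * M / m) * δ * k ∧
      (interior {x ∈ Ω | 0 < u x - k * ⟪p - x, n⟫}).Nonempty ∧
      ∃ c : E2, ∀ z ∈ {x ∈ Ω | 0 < u x - k * ⟪p - x, n⟫},
        c + sqz n (δ * (m / (2 * M))) (m / (2 * M)) z ∈ {x ∈ Ω | 0 < u x - k * ⟪p - x, n⟫} ∧
        ∀ g : E2, (∀ y ∈ Ω, u y - u (c + sqz n (δ * (m / (2 * M))) (m / (2 * M)) z) ≤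
          ⟪g, y - (c + sqz n (δ * (m / (2 * M))) (m / (2 * M)) z)⟫) →
          1 + ‖g‖ < (4 + 6 * M / m) * δ * k := by
  have hnn : ⟪n, n⟫ = 1 := by rw [real_inner_self_eq_norm_sq, hn]; norm_num
  have hττ : ⟪τ, τ⟫ = 1 := by rw [real_inner_self_eq_norm_sq, hτ1]; norm_num
  have hnτ : ⟪n, τ⟫ = 0 := by rw [real_inner_comm]; exact hτ
  obtain ⟨R, hR⟩ : ∃ R, R = 2 * M / δ := ⟨_, rfl⟩
  have hRpos : 0 < R := by rw [hR]; positivity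
  obtain ⟨ρ₁, hρ₁, hw⟩ := hwedge (m / (2 * R)) (by positivity)
  obtain ⟨ρ₂, hρ₂, hg⟩ := hgrad (M * δ) (by positivity)
  obtain ⟨k, hk⟩ : ∃ k, k = 1 / δ + m / r₁ + (m + R) / ρ₁ + 2 * m / ρ₂ := ⟨_, rfl⟩
  have q1 : 0 < 1 / δ := by positivity
  have q2 : 0 < m / r₁ := by positivity
  have q3 : 0 < (m + R) / ρ₁ := by positivity
  have q4 : 0 < 2 * m / ρ₂ := by positivity
  have hkpos : 0 < k := by linarith
  have k1 : 1 ≤ δ * k := by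
    have : 1 / δ ≤ k := by linarith
    rw [div_le_iff₀ hδ] at this; linarith
  have k2 : m / k ≤ r₁ := by
    have : m / r₁ ≤ k := by linarith
    rw [div_le_iff₀ hr₁] at this
    rw [div_le_iff₀ hkpos]; linarith
  have k3 : m / k + R / k ≤ ρ₁ := by
    have : (m + R) / ρ₁ ≤ k := by linarith
    rw [div_le_iff₀ hρ₁] at this
    rw [← add_div, div_le_iff₀ hkpos]; linarith
  have k4 : m / k < ρ₂ := by
    have : 2 * m / ρ₂ ≤ k := by linarith
    rw [div_le_iff₀ hρ₂] at this
    rw [div_lt_iff₀ hkpos]; linarith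
  clear hk
  obtain ⟨σ, hσ⟩ : ∃ σ, σ = m / k := ⟨_, rfl⟩
  have hσpos : 0 < σ := by rw [hσ]; positivity
  have hkσ : k * σ = m := by rw [hσ]; field_simp
  rw [← hσ] at k2 k3 k4
  obtain ⟨θ, hθ⟩ : ∃ θ, θ = m / (2 * M) := ⟨_, rfl⟩
  have hθpos : 0 < θ := by rw [hθ]; positivity
  have hθ2 : θ ≤ 1 / 2 := by
    rw [hθ, div_le_iff₀ (by positivity)]; linarith
  have hθM : θ * M = m / 2 := by rw [hθ]; field_simp
  rw [← hθ]
  have hconc := concave_sub_lin hu k p n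
  have hDconv : Convex ℝ {x ∈ Ω | 0 < u x - k * ⟪p - x, n⟫} := hconc.convex_gt 0
  have hDlow : ∀ r : ℝ, 0 < r → r ≤ σ → p - r • n ∈ {x ∈ Ω | 0 < u x - k * ⟪p - x, n⟫} := by
    intro r hr hrσ
    obtain ⟨h1, h2⟩ := hlow r hr (hrσ.trans k2)
    refine ⟨interior_subset h1, ?_⟩
    have : ⟪p - (p - r • n), n⟫ = r := by
      rw [sub_sub_cancel, inner_smul_left, hnn]; simp
    rw [this]
    have : k * r ≤ k * σ := by gcongr
    linarith
  have hDne : (interior {x ∈ Ω | 0 < u x - k * ⟪p - x, n⟫}).Nonempty :=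
    interior_pos_nonempty hconc (hlow σ hσpos k2).1 (hDlow σ hσpos le_rfl).2
  have hMm : 0 < 6 * M / m := by positivity
  have hC1 : 1 < (4 + 6 * M / m) * δ * k := by
    have h1 : (4 + 6 * M / m) * δ * k = 4 * (δ * k) + 6 * M / m * (δ * k) := by ring
    have h2 : 0 < 6 * M / m * (δ * k) := by positivity
    rw [h1]
    linarith
  refine ⟨k, hkpos, hC1, hDne, p - sqz n (δ * θ) θ p - (σ / 2) • n, fun z hz => ?_⟩
  obtain ⟨t, ht⟩ : ∃ t, t = ⟪z - p, τ⟫ := ⟨_, rfl⟩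
  obtain ⟨s, hs'⟩ : ∃ s, s = ⟪p - z, n⟫ := ⟨_, rfl⟩
  have hsn : ⟪z - p, n⟫ = -s := by rw [hs', ← neg_sub p z, inner_neg_left]
  have hz' : z = p + t • τ - s • n := by
    have := hdec (z - p)
    rw [← ht, hsn] at this
    rw [sub_eq_iff_eq_add] at this
    rw [this]; module
  obtain ⟨h, hh⟩ : ∃ h, h = θ * s + σ / 2 := ⟨_, rfl⟩
  have hx : p - sqz n (δ * θ) θ p - (σ / 2) • n + sqz n (δ * θ) θ z
      = p + (δ * θ * t) • τ - h • n := by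
    have : p - sqz n (δ * θ) θ p - (σ / 2) • n + sqz n (δ * θ) θ z
      = p + sqz n (δ * θ) θ (z - p) - (σ / 2) • n := by rw [map_sub]; abel
    rw [this]
    have : sqz n (δ * θ) θ (z - p) =
      (δ * θ) • (z - p) + ((θ - δ * θ) * ⟪z - p, n⟫) • n := rfl
    rw [this, hsn, hz', hh]
    module
  rw [hx]
  have hs0 : 0 ≤ s := by rw [hs']; exact hs z hz.1
  have hks : k * s < M := by
    have := hz.2
    rw [← hs'] at this
    linarith [(hub z hz.1).2]
  have hh1 : σ / 2 ≤ h := by rw [hh]; nlinarith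
  have hh2 : h ≤ σ := by
    have h1 : k * (θ * s) ≤ k * (σ / 2) := by nlinarith
    have := le_of_mul_le_mul_left h1 hkpos
    linarith
  have hhpos : 0 < h := by linarith
  -- the points on the slice
  have he1 : p - h • n ∈ {x ∈ Ω | 0 < u x - k * ⟪p - x, n⟫} := hDlow h hhpos hh2
  have hm0 : p + (θ * t) • τ - h • n ∈ {x ∈ Ω | 0 < u x - k * ⟪p - x, n⟫} := by
    have hr' : σ / 2 / (1 - θ) ≤ σ := by
      rw [div_le_iff₀ (by linarith)]; nlinarith
    have h1 := hDlow (σ / 2 / (1 - θ)) (div_pos (by linarith) (by linarith)) hr'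
    have h2 := hDconv hz h1 hθpos.le (show 0 ≤ 1 - θ by linarith) (by ring)
    convert h2 using 1
    have h3 : (1 - θ) * (σ / 2 / (1 - θ)) = σ / 2 := by
      have : 1 - θ ≠ 0 := by linarith
      field_simp
    rw [smul_sub, smul_smul, h3, hz', hh]
    module
  have hcomb : ∀ v : E2, p - h • n + v ∈ Ω →
      p + (δ * θ * t) • τ - h • n + (1 - δ) • v ∈ Ω := by
    intro v hv
    have h2 := hΩ.2.1 hv hm0.1 (show 0 ≤ 1 - δ by linarith) hδ.le (by ring)
    convert h2 using 1
    module
  have hxD : p + (δ * θ * t) • τ - h • n ∈ {x ∈ Ω | 0 < u x - k * ⟪p - x, n⟫} := by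
    have h2 := hDconv he1 hm0 (show 0 ≤ 1 - δ by linarith) hδ.le (by ring)
    convert h2 using 1
    module
  refine ⟨hxD, fun g hgx => ?_⟩
  obtain ⟨x, hxdef⟩ : ∃ x, x = p + (δ * θ * t) • τ - h • n := ⟨_, rfl⟩
  rw [← hxdef] at hgx hcomb hxD
  obtain ⟨a, ha⟩ : ∃ a, a = ⟪g, τ⟫ := ⟨_, rfl⟩
  obtain ⟨b, hb⟩ : ∃ b, b = ⟪g, -n⟫ := ⟨_, rfl⟩
  have hb2 : ⟪g, n⟫ = -b := by rw [hb, inner_neg_right, neg_neg]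
  have hgM : ∀ v : E2, x + v ∈ Ω → -M ≤ ⟪g, v⟫ := by
    intro v hv
    have h1 := hgx _ hv
    rw [add_sub_cancel_left] at h1
    linarith [(hub _ hv).1, (hub _ hxD.1).2]
  -- tangential room
  have t1 : -M ≤ (1 - δ) * θ * t * a := by
    have := hgM (((1 - δ) * θ * t) • τ) (by
      convert hm0.1 using 1
      rw [hxdef]; module)
    rwa [inner_smul_right, ← ha] at this
  have t2 : -(M * δ) ≤ -(δ * θ * t * a) + -(b * h) := by
    have h1 : ⟪p - x, n⟫ = h := by
      have : p - x = h • n - (δ * θ * t) • τ := by rw [hxdef]; module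
      rw [this, inner_sub_left, inner_smul_left, inner_smul_left, hnn, hτ]; simp
    have h2 := hg x hxD.1 (by rw [h1]; linarith) g hgx
    have : p - x = h • n - (δ * θ * t) • τ := by rw [hxdef]; module
    rw [this, inner_sub_right, inner_smul_right, inner_smul_right, ← ha, hb2] at h2
    linarith
  have hWe : R / k * (δ * k) = 2 * M := by rw [hR]; field_simp
  have hW0 : 0 < R / k := by positivity
  have hηW : m / (2 * R) * (R / k) = σ / 2 := by rw [hσ]; field_simp
  obtain ⟨W, hWdef⟩ : ∃ W, W = R / k := ⟨_, rfl⟩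
  rw [← hWdef] at hWe hW0 hηW k3
  have w1 : -M ≤ (1 - δ) * W * a := by
    have h1 := hw W h (by rw [abs_of_pos hW0, hηW]; exact hh1) (by linarith)
    have h2 := hgM _ (hcomb (W • τ) (by convert h1 using 1; module))
    rw [inner_smul_right, inner_smul_right, ← ha] at h2
    linarith
  have w2 : -M ≤ -((1 - δ) * W * a) := by
    have h1 := hw (-W) h (by rw [abs_neg, abs_of_pos hW0, hηW]; exact hh1) (by linarith)
    have h2 := hgM _ (hcomb ((-W) • τ) (by convert h1 using 1; module))
    rw [inner_smul_right, inner_smul_right, ← ha] at h2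
    linarith
  have w3 : -M ≤ (1 - δ) * W * b := by
    have h1 := hw 0 (h + W) (by rw [abs_zero]; linarith) (by linarith)
    have h2 := hgM _ (hcomb ((-W) • n) (by convert h1 using 1; module))
    rw [inner_smul_right, inner_smul_right, hb2] at h2
    linarith
  have hWhalf : W / 2 ≤ (1 - δ) * W := by nlinarith
  have room : ∀ q : ℝ, -M ≤ (1 - δ) * W * q → -(δ * k) ≤ q := by
    intro q hq
    by_contra hlt
    push Not at hlt
    have h1 : W / 2 * (δ * k) = M := by linarith
    have hδk : 0 < δ * k := by positivity
    have h2 : (1 - δ) * W * q < (1 - δ) * W * (-(δ * k)) := by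
      apply mul_lt_mul_of_pos_left hlt; linarith
    have h3 : W / 2 * (δ * k) ≤ (1 - δ) * W * (δ * k) := by gcongr
    linarith
  have a1 := room a w1
  have a2 := room (-a) (by linarith)
  have b1 := room b w3
  have b2 : b ≤ 6 * M / m * (δ * k) := by
    by_cases hb0 : b ≤ 0
    · have : 0 ≤ 6 * M / m * (δ * k) := by positivity
      linarith
    push Not at hb0
    -- tangential term
    have h1 : -(2 * M * δ) ≤ δ * θ * t * a := by
      by_contra hlt
      push Not at hlt
      have h2 : θ * t * a < -(2 * M) := by
        have : δ * (θ * t * a) < δ * (-(2 * M)) := by linarith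
        exact lt_of_mul_lt_mul_left this hδ.le
      have h6 : (1 - δ) * (θ * t * a) < (1 - δ) * (-(2 * M)) := by
        apply mul_lt_mul_of_pos_left h2; linarith
      have h7 : 1 / 2 * (2 * M) ≤ (1 - δ) * (2 * M) := by gcongr; linarith
      linarith
    have h3 : b * h ≤ 3 * M * δ := by linarith
    have h4 : b * (σ / 2) ≤ 3 * M * δ := le_trans (by gcongr) h3
    have h5 : b * m ≤ 6 * M * δ * k := by
      have h6 : 2 * k * (b * (σ / 2)) ≤ 2 * k * (3 * M * δ) := by gcongr
      rw [← hkσ]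
      linarith
    rw [div_mul_eq_mul_div, le_div_iff₀ hm]
    linarith
  have hgn : ‖g‖ ≤ |a| + |b| := by
    rw [hdec g, ← ha, hb2]
    refine (norm_add_le _ _).trans ?_
    rw [norm_smul, norm_smul, hτ1, hn]
    simp
  have habs : |a| ≤ δ * k := abs_le.mpr ⟨a1, by linarith⟩
  have hMk : 0 < 6 * M / m * (δ * k) := by positivity
  have hbabs : |b| ≤ δ * k + 6 * M / m * (δ * k) := abs_le.mpr ⟨by linarith, by linarith⟩
  have hfin : (4 + 6 * M / m) * δ * k = 4 * (δ * k) + 6 * M / m * (δ * k) := by ring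
  rw [hfin]
  linarith

lemma f_bounded {f : E2 → ℝ} (hfpos : ∀ x, 0 < f x) (hfcont : Continuous f) (hA : CondA f) :
    ∃ B : ℝ, ∀ x, ‖f x‖ ≤ B := by
  obtain ⟨δ, hδ, h⟩ := hA 1 one_pos
  obtain ⟨B, hB⟩ := (isCompact_closedBall (0 : E2) (1 / δ)).exists_bound_of_continuousOn
    hfcont.continuousOn
  refine ⟨max B (f 0 * δ), fun y => ?_⟩
  by_cases hy : ‖y‖ ≤ 1 / δ
  · exact (hB y (by simpa using hy)).trans (le_max_left _ _)
  · push Not at hy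
    refine le_trans ?_ (le_max_right _ _)
    have h1 : 1 < δ * ‖y‖ := by rw [div_lt_iff₀ hδ] at hy; linarith
    have h2 := h 0 y (by simpa using h1)
    have hy0 : 0 < ‖y‖ := lt_trans (by positivity) hy
    have hfy := hfpos y
    rw [lt_div_iff₀ (by positivity)] at h2
    simp only [norm_zero, add_zero, one_mul] at h2
    rw [Real.norm_of_nonneg hfy.le]
    by_contra hlt
    push Not at hlt
    have : f 0 < f 0 * (δ * ‖y‖) := by
      have := hfpos 0
      nlinarith
    nlinarith

lemma int_on {f : E2 → ℝ} (hfpos : ∀ x, 0 < f x) (hfcont : Continuous f) (hA : CondA f)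
    {Ω : Set E2} (hΩ : IsCompact Ω) (u : E2 → ℝ) :
    IntegrableOn (fun x => f (gradient u x)) Ω := by
  obtain ⟨B, hB⟩ := f_bounded hfpos hfcont hA
  have hmeas : Measurable (fun x => gradient u x) :=
    (InnerProductSpace.toDual ℝ E2).symm.continuous.measurable.comp (measurable_fderiv ℝ u)
  exact Measure.integrableOn_of_bounded hΩ.measure_lt_top.ne
    (hfcont.measurable.comp hmeas).aestronglyMeasurable (ae_of_all _ fun x => hB _)

lemma energy {Ω : Set E2} (hΩ : IsConvexBody Ω) {M : ℝ}
    {f : E2 → ℝ} (hfpos : ∀ x, 0 < f x) (hfcont : Continuous f) (hA : CondA f)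
    {u : E2 → ℝ} (hu : ConcaveOn ℝ Ω u) (hub : ∀ x ∈ Ω, u x ∈ Icc 0 M)
    (hmin : ∀ v : E2 → ℝ, ConcaveOn ℝ Ω v → (∀ x ∈ Ω, v x ∈ Icc 0 M) →
      ∫ x in Ω, f (gradient u x) ≤ ∫ x in Ω, f (gradient v x))
    {p n : E2} (hs : ∀ x ∈ Ω, 0 ≤ ⟪p - x, n⟫) {k : ℝ} (hk : 0 < k) :
    ∫ x in interior {x ∈ Ω | 0 < u x - k * ⟪p - x, n⟫}, f (gradient u x) ≤
      volume.real (interior {x ∈ Ω | 0 < u x - k * ⟪p - x, n⟫}) * f (-(k • n)) := by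
  set D := {x ∈ Ω | 0 < u x - k * ⟪p - x, n⟫} with hD
  have hDconv : Convex ℝ D := (concave_sub_lin hu k p n).convex_gt 0
  have hDΩ : D ⊆ Ω := fun x hx => hx.1
  have hUΩ : interior D ⊆ Ω := interior_subset.trans hDΩ
  let v : E2 → ℝ := fun x => min (u x) (k * ⟪p - x, n⟫)
  have hv : ConcaveOn ℝ Ω v := hu.inf (concave_lin hΩ.2.1 k p n)
  have hvb : ∀ x ∈ Ω, v x ∈ Icc 0 M := fun x hx =>
    ⟨le_min (hub x hx).1 (mul_nonneg hk.le (hs x hx)), (min_le_left _ _).trans (hub x hx).2⟩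
  have h := hmin v hv hvb
  have iu := int_on hfpos hfcont hA hΩ.1 u
  have iv := int_on hfpos hfcont hA hΩ.1 v
  have mU : MeasurableSet (interior D) := isOpen_interior.measurableSet
  rw [← integral_inter_add_sdiff mU iu, ← integral_inter_add_sdiff mU iv,
    inter_eq_self_of_subset_right hUΩ] at h
  have h1 : ∫ x in interior D, f (gradient v x) = volume.real (interior D) * f (-(k • n)) := by
    have : ∀ x ∈ interior D, f (gradient v x) = f (-(k • n)) := by
      intro x hx
      congr 1
      have he : v =ᶠ[𝓝 x] fun x => k * ⟪p - x, n⟫ := by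
        filter_upwards [isOpen_interior.mem_nhds hx] with y hy
        have := (interior_subset hy).2
        exact min_eq_right (by linarith)
      have hd : HasGradientAt (fun x => k * ⟪p - x, n⟫) (-(k • n)) x := by
        rw [hasGradientAt_iff_hasFDerivAt]
        have h2 : HasFDerivAt (fun x => k * ⟪p, n⟫ + InnerProductSpace.toDual ℝ E2 (-(k • n)) x)
            (InnerProductSpace.toDual ℝ E2 (-(k • n))) x :=
          (InnerProductSpace.toDual ℝ E2 (-(k • n))).hasFDerivAt.const_add _
        have h3 : (fun x => k * ⟪p - x, n⟫) =
            fun x => k * ⟪p, n⟫ + InnerProductSpace.toDual ℝ E2 (-(k • n)) x := by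
          funext y
          rw [InnerProductSpace.toDual_apply_apply, inner_neg_left, inner_smul_left,
            inner_sub_left, real_inner_comm n y]
          simp only [RCLike.conj_to_real]
          ring
        rw [h3]
        exact h2
      have : HasGradientAt v (-(k • n)) x := by
        rw [hasGradientAt_iff_hasFDerivAt] at hd ⊢
        exact hd.congr_of_eventuallyEq he
      exact this.gradient
    rw [setIntegral_congr_fun mU this, setIntegral_const, smul_eq_mul]
  have h2 : ∫ x in Ω \ interior D, f (gradient v x) = ∫ x in Ω \ interior D, f (gradient u x) := by
    apply setIntegral_congr_ae (hΩ.1.measurableSet.diff mU)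
    have z1 := measure_eq_zero_iff_ae_notMem.mp (hΩ.2.1.addHaar_frontier volume)
    have z2 := measure_eq_zero_iff_ae_notMem.mp (hDconv.addHaar_frontier volume)
    filter_upwards [z1, z2] with x hx1 hx2 hx
    have y1 : x ∈ interior Ω := by
      by_contra hc
      exact hx1 ⟨subset_closure hx.1, hc⟩
    have y2 : x ∉ closure D := fun hc => hx2 ⟨hc, hx.2⟩
    have he : v =ᶠ[𝓝 x] u := by
      filter_upwards [isOpen_interior.mem_nhds y1, isClosed_closure.isOpen_compl.mem_nhds y2]
        with y hy1 hy2
      have : ¬ (0 < u y - k * ⟪p - y, n⟫) := fun hc =>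
        hy2 (subset_closure ⟨interior_subset hy1, hc⟩)
      exact min_eq_left (by linarith)
    unfold gradient
    rw [he.fderiv_eq]
  rw [h1, h2] at h
  linarith

/-- If `u` minimizes `F(u) = ∫_Ω f(∇u)` over the class of concave functions
`u : Ω → [0, M]`, `f` satisfies Condition (A), and all points of `∂Ω` are
regular, then `u = 0` on `∂Ω`. -/
theorem boundary_value_zero
    (Ω : Set E2) (hΩ : IsConvexBody Ω) (M : ℝ) (hM : 0 < M)
    (f : E2 → ℝ) (hfpos : ∀ x, 0 < f x) (hfcont : Continuous f) (hA : CondA f)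
    (hreg : ∀ p ∈ frontier Ω, RegularPt Ω p)
    (u : E2 → ℝ) (hu : ConcaveOn ℝ Ω u) (hub : ∀ x ∈ Ω, u x ∈ Icc 0 M)
    (hmin : ∀ v : E2 → ℝ, ConcaveOn ℝ Ω v → (∀ x ∈ Ω, v x ∈ Icc 0 M) →
      ∫ x in Ω, f (gradient u x) ≤ ∫ x in Ω, f (gradient v x)) :
    ∀ x ∈ frontier Ω, u x = 0 := by
  intro p₀ hp₀
  have hcl : IsClosed Ω := hΩ.1.isClosed
  have hp₀Ω : p₀ ∈ Ω := hcl.frontier_subset hp₀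
  by_contra hne
  have hpos : 0 < u p₀ := lt_of_le_of_ne (hub p₀ hp₀Ω).1 (Ne.symm hne)
  obtain ⟨n, hn, -⟩ := hreg p₀ hp₀
  obtain ⟨L, p, hL, hp, hp0, hup, y, c, hy, hyp, hcL, hcu⟩ := pick_point hΩ.1 hp₀Ω hn hub
  have hLpos : 0 < L := by linarith
  have hs : ∀ x ∈ Ω, 0 ≤ ⟪p - x, n⟫ := by
    intro x hx
    have h1 := hn.2 x hx
    have : ⟪p₀ - x, n⟫ = ⟪p₀ - p, n⟫ + ⟪p - x, n⟫ := by
      rw [← inner_add_left]; congr 1; abel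
    rw [this, hp0, zero_add] at h1
    exact h1
  have hnn : ⟪n, n⟫ = 1 := by rw [real_inner_self_eq_norm_sq, hn.1]; norm_num
  have hpf : p ∈ frontier Ω := by
    refine ⟨subset_closure hp, fun hint => ?_⟩
    obtain ⟨r, hr, hball⟩ := Metric.mem_nhds_iff.mp (mem_interior_iff_mem_nhds.mp hint)
    have h1 : p + (r / 2) • n ∈ Ω := hball (by
      rw [mem_ball_iff_norm, add_sub_cancel_left, norm_smul, hn.1, Real.norm_of_nonneg (by linarith)]
      linarith)
    have h2 := hs _ h1
    rw [sub_add_cancel_left, inner_neg_left, inner_smul_left, hnn] at h2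
    simp at h2
    linarith
  have hpn : IsSupportNormal Ω p n := ⟨hn.1, hs⟩
  have huniq : ∀ n', IsSupportNormal Ω p n' → n' = n := fun n' h' =>
    (hreg p hpf).unique h' hpn
  obtain ⟨τ, hτ1, hτ, hdec⟩ := exists_tau n hn.1
  obtain ⟨r₁, hr₁, hlow⟩ := lower_near hΩ hp hn.1 huniq hu (fun x hx => (hub x hx).1) hLpos
    hy hyp hcL hcu
  have hmM : L / 4 ≤ M := by
    have h1 := hlow r₁ hr₁ le_rfl
    exact h1.2.le.trans (hub _ (interior_subset h1.1)).2
  have hgrad : ∀ ε : ℝ, 0 < ε → ∃ ρ : ℝ, 0 < ρ ∧ ∀ x ∈ Ω, ⟪p - x, n⟫ < ρ →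
      ∀ g : E2, (∀ y ∈ Ω, u y - u x ≤ ⟪g, y - x⟫) → -ε ≤ ⟪g, p - x⟫ := by
    intro ε hε
    obtain ⟨ρ, hρ, h⟩ := hup ε hε
    refine ⟨ρ, hρ, fun x hx hxρ g hg => ?_⟩
    have h1 := h x hx hxρ
    have h2 : Tendsto (fun j => ⟪g, y j - x⟫) atTop (𝓝 ⟪g, p - x⟫) :=
      tendsto_const_nhds.inner (hyp.sub tendsto_const_nhds)
    have h3 : Tendsto (fun j => c j - u x) atTop (𝓝 (L - u x)) := hcL.sub tendsto_const_nhds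
    have h4 := le_of_tendsto_of_tendsto' h3 h2 (fun j => by
      have := hg _ (hy j)
      linarith [hcu j])
    linarith
  have hcore := core hΩ hn.1 hτ1 hτ hdec hs hu hM hub (show 0 < L / 4 by linarith) hmM hr₁ hlow
    hgrad (fun η hη => wedge_mem hΩ hp hn.1 hτ huniq hη)
  obtain ⟨m, hm⟩ : ∃ m, m = L / 4 := ⟨_, rfl⟩
  rw [← hm] at hcore hmM
  have hmpos : 0 < m := by linarith
  obtain ⟨C, hC⟩ : ∃ C, C = 4 + 6 * M / m := ⟨_, rfl⟩
  obtain ⟨θ, hθ⟩ : ∃ θ, θ = m / (2 * M) := ⟨_, rfl⟩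
  have hCpos : 0 < C := by rw [hC]; positivity
  have hθpos : 0 < θ := by rw [hθ]; positivity
  rw [← hC, ← hθ] at hcore
  obtain ⟨δ₀, hδ₀, hAδ⟩ := hA (2 * C / θ ^ 2) (by positivity)
  obtain ⟨δ, hδ⟩ : ∃ δ, δ = min (δ₀ / C) (1 / 2) := ⟨_, rfl⟩
  have hδpos : 0 < δ := by rw [hδ]; positivity
  have hδ2 : δ ≤ 1 / 2 := by rw [hδ]; exact min_le_right _ _
  have hδC : C * δ ≤ δ₀ := by
    have : δ ≤ δ₀ / C := by rw [hδ]; exact min_le_left _ _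
    rw [le_div_iff₀ hCpos] at this
    linarith
  obtain ⟨k, hk, hk1, hDne, c', hT⟩ := hcore δ hδpos hδ2
  have hen := energy hΩ hfpos hfcont hA hu hub hmin hs hk
  set D := {x ∈ Ω | 0 < u x - k * ⟪p - x, n⟫} with hD
  have hDΩ : D ⊆ Ω := fun x hx => hx.1
  have hUΩ : interior D ⊆ Ω := interior_subset.trans hDΩ
  set A := sqz n (δ * θ) θ with hAdef
  have hdet : LinearMap.det A = δ * θ * θ := det_sqz n hn.1 _ _
  have hdetpos : 0 < δ * θ * θ := by positivity
  -- the image of the interior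
  set G : Set E2 := (fun z => c' + A z) '' interior D with hG
  have hGD : G ⊆ D := by
    rintro _ ⟨z, hz, rfl⟩
    exact (hT z (interior_subset hz)).1
  have hGopen : IsOpen G := by
    have h1 : G = (fun z => c' + z) '' (A '' interior D) := by rw [hG, image_image]
    rw [h1]
    apply isOpenMap_add_left c'
    have h2 : Function.Surjective A := by
      have := (A.equivOfDetNeZero (by rw [hdet]; positivity)).surjective
      exact this
    exact A.isOpenMap_of_finiteDimensional h2 _ isOpen_interior
  have hGU : G ⊆ interior D := interior_maximal hGD hGopen
  have hvol : volume.real G = δ * θ * θ * volume.real (interior D) := by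
    have h1 : G = (fun z => c' + z) '' (A '' interior D) := by rw [hG, image_image]
    have h2 : volume G = ENNReal.ofReal (δ * θ * θ) * volume (interior D) := by
      rw [h1, image_add_left, measure_preimage_add, Measure.addHaar_image_linearMap, hdet,
        abs_of_pos hdetpos]
    rw [measureReal_def, h2, ENNReal.toReal_mul, ENNReal.toReal_ofReal hdetpos.le, measureReal_def]
  have hUfin : volume (interior D) ≠ ⊤ :=
    ((measure_mono hUΩ).trans_lt hΩ.1.measure_lt_top).ne
  have hGfin : volume G ≠ ⊤ := ((measure_mono hGU).trans_lt hUfin.lt_top).ne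
  have hUpos : 0 < volume.real (interior D) :=
    ENNReal.toReal_pos (isOpen_interior.measure_pos volume hDne).ne' hUfin
  have hfk := hfpos (-(k • n))
  have hnk : ‖-(k • n)‖ = k := by
    rw [norm_neg, norm_smul, hn.1, Real.norm_of_nonneg hk.le, mul_one]
  have hpt : ∀ x ∈ G, 2 / (θ ^ 2 * δ) * f (-(k • n)) ≤ f (gradient u x) := by
    rintro x ⟨z, hz, rfl⟩
    obtain ⟨h1, h2⟩ := hT z (interior_subset hz)
    simp only
    set x := c' + A z with hx
    have h3 : 1 + ‖gradient u x‖ < C * δ * k := by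
      by_cases hd : DifferentiableAt ℝ u x
      · exact h2 _ (fun w hw => grad_ineq hu (hDΩ h1) hw hd)
      · have : gradient u x = 0 := by
          unfold gradient
          rw [fderiv_zero_of_not_differentiableAt hd, map_zero]
        rw [this, norm_zero, add_zero]
        exact hk1
    have h4 := hAδ (gradient u x) (-(k • n)) (by
      rw [hnk]
      have : C * δ * k ≤ δ₀ * k := by gcongr
      linarith)
    rw [hnk, lt_div_iff₀ (by positivity)] at h4
    have h5 : (1 + ‖gradient u x‖) * f (gradient u x) ≤ C * δ * k * f (gradient u x) := by
      have := hfpos (gradient u x)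
      gcongr
    have h6 : C * δ * k * (2 / (θ ^ 2 * δ) * f (-(k • n))) = 2 * C / θ ^ 2 * (k * f (-(k • n))) := by
      field_simp
    have h7 : 0 < C * δ * k := by positivity
    refine le_of_mul_le_mul_left ?_ h7
    rw [h6]
    linarith
  have iu := int_on hfpos hfcont hA hΩ.1 u
  have hl1 : ∫ x in G, f (gradient u x) ≤ ∫ x in interior D, f (gradient u x) :=
    setIntegral_mono_set (iu.mono_set hUΩ) (ae_of_all _ fun x => (hfpos _).le)
      (ae_of_all _ hGU)
  have hl2 : 2 / (θ ^ 2 * δ) * f (-(k • n)) * volume.real G ≤ ∫ x in G, f (gradient u x) := by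
    have h1 : ∫ x in G, 2 / (θ ^ 2 * δ) * f (-(k • n)) ≤ ∫ x in G, f (gradient u x) :=
      setIntegral_mono_on (integrableOn_const hGfin) (iu.mono_set (hGU.trans hUΩ))
        hGopen.measurableSet hpt
    rw [setIntegral_const, smul_eq_mul] at h1
    linarith
  have hl3 : 2 / (θ ^ 2 * δ) * f (-(k • n)) * volume.real G
      = 2 * (volume.real (interior D) * f (-(k • n))) := by
    rw [hvol]; field_simp
  have : 0 < volume.real (interior D) * f (-(k • n)) := by positivity
  linarith
end
end

section
/- (Buttazzo–Kawohl conjecture for Newton's problem.) Let Ω ⊂ ℝ² be the closed unit disk, f(x) = 1/(1 + |x|²), and M > 0. If u is a minimizer of F(u) = ∫_Ω f(∇u(x)) dx over the class C_M, then u(x) = 0 for every x ∈ ∂Ω. -/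
noncomputable section

open MeasureTheory Set Filter
open scoped RealInnerProductSpace Topology

/-- Area of a rectangle in an orthonormal frame. -/
lemma volume_rect (b : OrthonormalBasis (Fin 2) ℝ E2) (p q r s : ℝ) :
    volume {z : E2 | ⟪b 0, z⟫ ∈ Icc p q ∧ ⟪b 1, z⟫ ∈ Icc r s} =
      ENNReal.ofReal (q - p) * ENNReal.ofReal (s - r) := by
  have h1 : MeasurePreserving (fun z : E2 => WithLp.ofLp (b.repr z)) :=
    (PiLp.volume_preserving_ofLp (Fin 2)).comp b.measurePreserving_repr
  have h2 := h1.measure_preimage (s := Icc ![p, r] ![q, s]) measurableSet_Icc.nullMeasurableSet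
  rw [Real.volume_Icc_pi] at h2
  simp only [Fin.prod_univ_two, Matrix.cons_val_zero, Matrix.cons_val_one] at h2
  rw [← h2]
  congr 1
  ext z
  simp only [mem_ofPred_eq, mem_preimage, mem_Icc, Pi.le_def, Fin.forall_fin_two,
    Matrix.cons_val_zero, Matrix.cons_val_one, b.repr_apply_apply]
  tauto

lemma rect_measurable (b : OrthonormalBasis (Fin 2) ℝ E2) (p q r s : ℝ) :
    MeasurableSet {z : E2 | ⟪b 0, z⟫ ∈ Icc p q ∧ ⟪b 1, z⟫ ∈ Icc r s} := by
  apply IsClosed.measurableSet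
  have h0 : Continuous fun z : E2 => ⟪b 0, z⟫ := by fun_prop
  have h1 : Continuous fun z : E2 => ⟪b 1, z⟫ := by fun_prop
  exact (isClosed_Icc.preimage h0).inter (isClosed_Icc.preimage h1)

lemma ae_diff {M : ℝ} {u : E2 → ℝ}
    (hu : ConcaveOn ℝ (Metric.closedBall (0 : E2) 1) u)
    (hub : ∀ x ∈ Metric.closedBall (0 : E2) 1, u x ∈ Icc 0 M) :
    ∀ᵐ x : E2, x ∈ Metric.ball (0 : E2) 1 → DifferentiableAt ℝ u x := by
  have key : ∀ n : ℕ, ∀ᵐ x : E2, x ∈ Metric.ball (0 : E2) (1 - 1 / ((n : ℝ) + 1)) →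
      DifferentiableAt ℝ u x := by
    intro n
    have hn : (1 - 1 / ((n : ℝ) + 1)) < 1 := by
      have : 0 < 1 / ((n : ℝ) + 1) := by positivity
      linarith
    obtain ⟨K, hK⟩ := (hu.subset Metric.ball_subset_closedBall
      (convex_ball _ _)).exists_lipschitzOnWith_of_isBounded hn (by
        refine (Metric.isBounded_Icc (0 : ℝ) M).subset ?_
        rintro _ ⟨x, hx, rfl⟩
        exact hub x (Metric.ball_subset_closedBall hx))
    filter_upwards [hK.ae_differentiableWithinAt_of_mem (μ := volume)] with x hx hxs
    exact (hx hxs).differentiableAt (Metric.isOpen_ball.mem_nhds hxs)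
  filter_upwards [ae_all_iff.2 key] with x hx hx1
  rw [mem_ball_zero_iff] at hx1
  obtain ⟨n, hn⟩ := exists_nat_one_div_lt (sub_pos.2 hx1)
  exact hx n (by rw [mem_ball_zero_iff]; linarith)

lemma norm_gradient (u : E2 → ℝ) (x : E2) : ‖gradient u x‖ = ‖fderiv ℝ u x‖ := by
  unfold gradient
  simp

lemma integrable_res (u : E2 → ℝ) (S : Set E2) (hS : volume S ≠ ⊤) :
    IntegrableOn (fun x => 1 / (1 + ‖gradient u x‖ ^ 2)) S := by
  have hm : Measurable (fun x => 1 / (1 + ‖gradient u x‖ ^ 2)) := by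
    simp only [norm_gradient]
    have := measurable_fderiv ℝ u
    fun_prop
  refine Measure.integrableOn_of_bounded (M := 1) hS hm.aestronglyMeasurable ?_
  refine Eventually.of_forall fun x => ?_
  rw [Real.norm_of_nonneg (by positivity)]
  rw [div_le_one (by positivity)]
  nlinarith [sq_nonneg ‖gradient u x‖]

/-- Truncation by a steep affine function: cost versus gain. -/
lemma compare {M : ℝ} {u v l : E2 → ℝ} {g : E2}
    (hu : ConcaveOn ℝ (Metric.closedBall (0 : E2) 1) u)
    (hub : ∀ x ∈ Metric.closedBall (0 : E2) 1, u x ∈ Icc 0 M)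
    (hv : ConcaveOn ℝ (Metric.closedBall (0 : E2) 1) v)
    (hvb : ∀ x ∈ Metric.closedBall (0 : E2) 1, v x ∈ Icc 0 M)
    (hvl : v = fun x => min (u x) (l x))
    (hl : ∀ x, HasGradientAt l g x)
    (B R : Set E2) (hB : MeasurableSet B)
    (hBA : ∀ z ∈ B, z ∈ Metric.ball (0 : E2) 1 ∧ l z < u z)
    (hAR : ∀ z, z ∈ Metric.ball (0 : E2) 1 → l z < u z → z ∈ R)
    (hR : volume R ≠ ⊤)
    (α : ℝ) (hα : ∀ z ∈ B, α ≤ 1 / (1 + ‖gradient u z‖ ^ 2))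
    (hmin : ∫ x in Metric.closedBall (0 : E2) 1, 1 / (1 + ‖gradient u x‖ ^ 2) ≤
        ∫ x in Metric.closedBall (0 : E2) 1, 1 / (1 + ‖gradient v x‖ ^ 2)) :
    volume.real B * α ≤ volume.real R * (1 / (1 + ‖g‖ ^ 2)) := by
  set D := Metric.ball (0 : E2) 1 with hD
  have hDo : IsOpen D := Metric.isOpen_ball
  have hDfin : volume D ≠ ⊤ := measure_ball_lt_top.ne
  have hcb : (Metric.closedBall (0 : E2) 1 : Set E2) =ᵐ[volume] D := by
    rw [← Metric.ball_union_sphere]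
    exact union_ae_eq_left_of_ae_eq_empty (by
      rw [ae_eq_empty]; exact Measure.addHaar_sphere _ _ _)
  rw [setIntegral_congr_set hcb, setIntegral_congr_set hcb] at hmin
  have hlc : Continuous l := continuous_iff_continuousAt.2 fun x => (hl x).continuousAt
  have huc : ContinuousOn u D :=
    (hu.subset Metric.ball_subset_closedBall (convex_ball _ _)).continuousOn hDo
  set A := {z | z ∈ D ∧ l z < u z} with hA
  have hAo : IsOpen A := by
    rw [isOpen_iff_mem_nhds]
    rintro z ⟨hz, hzl⟩
    have h1 := hDo.mem_nhds hz
    have h2 : ContinuousAt u z := huc.continuousAt h1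
    filter_upwards [h1, hlc.continuousAt.eventually_lt h2 hzl] with y hy hy'
    exact ⟨hy, hy'⟩
  have hAD : A ⊆ D := fun z hz => hz.1
  have hAfin : volume A ≠ ⊤ := measure_ne_top_of_subset hAD hDfin
  have hgA : ∀ z ∈ A, gradient v z = g := by
    intro z hz
    have : v =ᶠ[𝓝 z] l := by
      filter_upwards [hAo.mem_nhds hz] with y hy
      rw [hvl]; exact min_eq_right hy.2.le
    exact ((hl z).congr_of_eventuallyEq this).gradient
  have hgC : ∀ᵐ z : E2, z ∈ D \ A → gradient u z = gradient v z := by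
    filter_upwards [ae_diff hu hub, ae_diff hv hvb] with z h1 h2 hz
    have hzle : u z ≤ l z := by
      by_contra h
      exact hz.2 ⟨hz.1, not_le.1 h⟩
    have h0 : IsLocalMin (fun x => u x - v x) z := by
      refine Eventually.of_forall fun y => ?_
      simp only [hvl, min_eq_left hzle, sub_self]
      exact sub_nonneg.2 (min_le_left _ _)
    have h3 := h0.fderiv_eq_zero
    rw [fderiv_fun_sub (h1 hz.1) (h2 hz.1)] at h3
    unfold gradient
    rw [sub_eq_zero.1 h3]
  have iu := integrable_res u D hDfin
  have iv := integrable_res v D hDfin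
  rw [← sdiff_union_of_subset hAD,
    setIntegral_union disjoint_sdiff_left hAo.measurableSet (iu.mono_set sdiff_subset)
      (iu.mono_set hAD),
    setIntegral_union disjoint_sdiff_left hAo.measurableSet (iv.mono_set sdiff_subset)
      (iv.mono_set hAD)] at hmin
  have heq : ∫ x in D \ A, 1 / (1 + ‖gradient u x‖ ^ 2) =
      ∫ x in D \ A, 1 / (1 + ‖gradient v x‖ ^ 2) := by
    apply setIntegral_congr_ae (hDo.measurableSet.diff hAo.measurableSet)
    filter_upwards [hgC] with z hz hz'
    rw [hz hz']
  have hA1 : ∫ x in A, 1 / (1 + ‖gradient v x‖ ^ 2) = volume.real A * (1 / (1 + ‖g‖ ^ 2)) := by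
    rw [setIntegral_congr_fun hAo.measurableSet
      (g := fun _ => 1 / (1 + ‖g‖ ^ 2)) (fun z hz => by simp only [hgA z hz])]
    simp
  have hBA' : B ⊆ A := fun z hz => hBA z hz
  have hB1 : volume.real B * α ≤ ∫ x in B, 1 / (1 + ‖gradient u x‖ ^ 2) := by
    have : ∫ x in B, α = volume.real B * α := by simp
    rw [← this]
    exact setIntegral_mono_on
      (integrableOn_const (measure_ne_top_of_subset hBA' hAfin))
      (iu.mono_set (hBA'.trans hAD)) hB hα
  have hB2 : ∫ x in B, 1 / (1 + ‖gradient u x‖ ^ 2) ≤ ∫ x in A, 1 / (1 + ‖gradient u x‖ ^ 2) :=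
    setIntegral_mono_set (iu.mono_set hAD) (Eventually.of_forall fun x => by
      simp only [Pi.zero_apply]; positivity) (LE.le.eventuallyLE hBA')
  have hR1 : volume.real A ≤ volume.real R := measureReal_mono (fun z hz => hAR z hz.1 hz.2) hR
  have hR2 : volume.real A * (1 / (1 + ‖g‖ ^ 2)) ≤ volume.real R * (1 / (1 + ‖g‖ ^ 2)) :=
    mul_le_mul_of_nonneg_right hR1 (by positivity)
  linarith

/-- Gradient bound from oscillation. -/
lemma grad_bound {u : E2 → ℝ} {z : E2} {h c m : ℝ} (hh : 0 < h) (hm : 0 ≤ m)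
    (hu : ConcaveOn ℝ (Metric.ball z h) u)
    (hb : ∀ w ∈ Metric.ball z h, |u w - c| ≤ m) : ‖gradient u z‖ ≤ 4 * m / h := by
  have h1 : ConcaveOn ℝ (Metric.ball z h) (fun w => u w + -c) :=
    hu.add_const (-c)
  have h2 := h1.lipschitzOnWith_of_abs_le (half_pos hh) (M := m) (fun a ha => by
    simpa [sub_eq_add_neg] using hb a ha)
  have h3 := norm_fderiv_le_of_lipschitzOn ℝ (Metric.ball_mem_nhds z (by linarith)) h2
  rw [norm_gradient]
  rw [fderiv_add_const] at h3
  rw [Real.coe_toNNReal _ (by positivity)] at h3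
  calc _ ≤ _ := h3
    _ = _ := by field_simp; ring

/-- Lower bound of a concave function in a disk tangent at `x0`. -/
lemma lower_bound_s2 {u : E2 → ℝ} {M : ℝ}
    (hu : ConcaveOn ℝ (Metric.closedBall (0 : E2) 1) u)
    (hub : ∀ x ∈ Metric.closedBall (0 : E2) 1, u x ∈ Icc 0 M)
    {x0 w : E2} {t a : ℝ} (ht : 0 < t) (ht1 : t < 1)
    (hq : ‖t⁻¹ • (w - (1 - t) • x0)‖ < 1)
    (hf : ∃ᶠ z in 𝓝[Metric.closedBall (0 : E2) 1] x0, a < u z) :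
    (1 - t) * a ≤ u w := by
  have hc : Continuous fun z : E2 => ‖t⁻¹ • (w - (1 - t) • z)‖ := by fun_prop
  have hev : ∀ᶠ z in 𝓝[Metric.closedBall (0 : E2) 1] x0, ‖t⁻¹ • (w - (1 - t) • z)‖ < 1 :=
    ((hc.tendsto x0).eventually_lt_const hq).filter_mono nhdsWithin_le_nhds
  obtain ⟨z, ⟨hz1, hz2⟩, hz3⟩ := ((hf.and_eventually hev).and_eventually
    self_mem_nhdsWithin).exists
  set q := t⁻¹ • (w - (1 - t) • z) with hqd
  have hqD : q ∈ Metric.closedBall (0 : E2) 1 := by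
    rw [mem_closedBall_zero_iff]; exact hz2.le
  have hw : (1 - t) • z + t • q = w := by
    rw [hqd, smul_inv_smul₀ ht.ne']; abel
  have h := hu.2 hz3 hqD (sub_nonneg.2 ht1.le) ht.le (by ring)
  rw [hw] at h
  simp only [smul_eq_mul] at h
  have h0 := (hub q hqD).1
  nlinarith [mul_nonneg ht.le h0, mul_lt_mul_of_pos_left hz1 (sub_pos.2 ht1)]

set_option maxHeartbeats 4000000 in
/-- The Buttazzo–Kawohl conjecture for Newton's problem of least resistance:
a minimizer of `∫_Ω dx/(1+|∇u(x)|²)` over concave functions `u : Ω → [0, M]`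
on the closed unit disk `Ω` vanishes on `∂Ω`. -/
theorem buttazzo_kawohl_newton
    (M : ℝ) (hM : 0 < M) (u : E2 → ℝ)
    (hu : ConcaveOn ℝ (Metric.closedBall (0 : E2) 1) u)
    (hub : ∀ x ∈ Metric.closedBall (0 : E2) 1, u x ∈ Icc 0 M)
    (hmin : ∀ v : E2 → ℝ, ConcaveOn ℝ (Metric.closedBall (0 : E2) 1) v →
      (∀ x ∈ Metric.closedBall (0 : E2) 1, v x ∈ Icc 0 M) →
      ∫ x in Metric.closedBall (0 : E2) 1, 1 / (1 + ‖gradient u x‖ ^ 2) ≤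
        ∫ x in Metric.closedBall (0 : E2) 1, 1 / (1 + ‖gradient v x‖ ^ 2)) :
    ∀ x ∈ frontier (Metric.closedBall (0 : E2) 1), u x = 0 := by

  intro x0 hx0
  rw [frontier_closedBall _ one_ne_zero, mem_sphere_zero_iff_norm] at hx0
  by_contra hne
  set D := Metric.closedBall (0 : E2) 1 with hD
  have hx0D : x0 ∈ D := by rw [hD, mem_closedBall_zero_iff, hx0]
  have hux0 : 0 < u x0 := lt_of_le_of_ne (hub x0 hx0D).1 (Ne.symm hne)
  -- orthonormal frame
  obtain ⟨b, hb0⟩ : ∃ b : OrthonormalBasis (Fin 2) ℝ E2, b 0 = x0 := by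
    obtain ⟨b, hb⟩ := Orthonormal.exists_orthonormalBasis_extension_of_card_eq
      (𝕜 := ℝ) (E := E2) (ι := Fin 2) (v := fun _ => x0) (s := {0}) (by simp) (by
        constructor
        · intro i; simpa using hx0
        · intro i j hij
          exact absurd (Subsingleton.elim i j) hij)
    exact ⟨b, hb 0 (by simp)⟩
  -- limsup
  set L := limsup u (𝓝[D] x0) with hL
  have hbd : IsBoundedUnder (· ≤ ·) (𝓝[D] x0) u :=
    isBoundedUnder_of_eventually_le (a := M) (by
      filter_upwards [self_mem_nhdsWithin] with z hz using (hub z hz).2)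
  have hpure : pure x0 ≤ 𝓝[D] x0 := pure_le_nhdsWithin hx0D
  have hcb : IsCoboundedUnder (· ≤ ·) (𝓝[D] x0) u := by
    have : (𝓝[D] x0).NeBot := neBot_of_le hpure
    exact IsBoundedUnder.isCoboundedUnder_le (isBoundedUnder_of_eventually_ge (a := 0) (by
      filter_upwards [self_mem_nhdsWithin] with z hz using (hub z hz).1))
  have hL0 : u x0 ≤ L := by
    apply le_limsup_of_frequently_le _ hbd
    exact Frequently.filter_mono (f := pure x0) (by simp) hpure
  have hLpos : 0 < L := hux0.trans_le hL0
  have hLM : L ≤ M := limsup_le_of_le hcb (by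
      filter_upwards [self_mem_nhdsWithin] with z hz using (hub z hz).2)
  -- parameters
  set m := M / L with hm
  have hm1 : 1 ≤ m := (one_le_div hLpos).2 hLM
  have hmL : m * L = M := div_mul_cancel₀ _ hLpos.ne'
  set t := 1 / (10000 * m) with ht
  have htpos : 0 < t := by positivity
  have htm : t * m = 1 / 10000 := by rw [ht]; field_simp
  have ht1 : t ≤ 1 / 10000 := by nlinarith
  have hlow : ∀ w : E2, ‖t⁻¹ • (w - (1 - t) • x0)‖ < 1 → (1 - t) * ((1 - t) * L) ≤ u w := by
    intro w hw
    refine lower_bound_s2 hu hub htpos (by linarith) hw (frequently_lt_of_lt_limsup hcb ?_)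
    nlinarith
  obtain ⟨ρ, hρ, hup⟩ : ∃ ρ > 0, ∀ w ∈ D, ‖w - x0‖ < ρ → u w ≤ (1 + t) * L := by
    have h1 : ∀ᶠ z in 𝓝[D] x0, u z < (1 + t) * L :=
      eventually_lt_of_limsup_lt (by nlinarith) hbd
    obtain ⟨ρ, hρ, h2⟩ := Metric.mem_nhdsWithin_iff.1 h1
    refine ⟨ρ, hρ, fun w hw hwρ => le_of_lt (h2 ⟨?_, hw⟩)⟩
    rwa [mem_ball_iff_norm]
  obtain ⟨h, hh, hht, hhL, hhρ⟩ : ∃ h : ℝ, 0 < h ∧ h ≤ t / 100 ∧ h ≤ t * L ∧ 8 * t * h < ρ ^ 2 := by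
    refine ⟨min (min (t / 100) (t * L)) (ρ ^ 2 / (16 * t)), by positivity,
      (min_le_left _ _).trans (min_le_left _ _), (min_le_left _ _).trans (min_le_right _ _), ?_⟩
    have h1 : min (min (t / 100) (t * L)) (ρ ^ 2 / (16 * t)) ≤ ρ ^ 2 / (16 * t) := min_le_right _ _
    rw [le_div_iff₀ (by positivity)] at h1
    have : 0 < ρ ^ 2 := by positivity
    linarith
  -- coordinates
  have hip : ⟪x0, x0⟫ = 1 := by rw [real_inner_self_eq_norm_sq, hx0]; norm_num
  have hnorm : ∀ z : E2, ‖z‖ ^ 2 = ⟪b 0, z⟫ ^ 2 + ⟪b 1, z⟫ ^ 2 := by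
    intro z
    rw [← b.sum_sq_norm_inner_right z]
    simp [Fin.sum_univ_two]
  have hb1x : ⟪b 1, x0⟫ = 0 := by
    rw [← hb0]; exact b.orthonormal.2 (by decide)
  have hnx : ∀ z : E2, ‖z - x0‖ ^ 2 = (1 - ⟪b 0, z⟫) ^ 2 + ⟪b 1, z⟫ ^ 2 := by
    intro z
    rw [hnorm, inner_sub_right, inner_sub_right, hb1x, hb0, hip]
    ring
  set q := √(m * h) with hq
  have hqpos : 0 < q := by positivity
  have hq2 : q ^ 2 = m * h := Real.sq_sqrt (by positivity)
  set w0 := q / (200 * m) with hw0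
  have hw0pos : 0 < w0 := by positivity
  have hw02 : w0 ^ 2 = t * h / 4 := by
    rw [hw0, div_pow, hq2, ht]; field_simp; norm_num
  set K := L / (8 * h) with hK
  have hKpos : 0 < K := by positivity
  have hKh : K * h = L / 8 := by rw [hK]; field_simp
  set l : E2 → ℝ := fun z => K * (1 - ⟪x0, z⟫) with hl
  set v : E2 → ℝ := fun z => min (u z) (l z) with hv
  have hlpos : ∀ z ∈ D, 0 ≤ l z := by
    intro z hz
    have h1 := real_inner_le_norm x0 z
    rw [hD, mem_closedBall_zero_iff] at hz
    rw [hx0] at h1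
    exact mul_nonneg hKpos.le (by linarith)
  have hvc : ConcaveOn ℝ D v := by
    refine hu.inf ⟨convex_closedBall _ _, ?_⟩
    intro x _ y _ a c _ _ hac
    simp only [hl, inner_add_right, inner_smul_right, smul_eq_mul]
    apply le_of_eq
    linear_combination K * hac
  have hvb : ∀ x ∈ D, v x ∈ Icc 0 M := fun x hx =>
    ⟨le_min (hub x hx).1 (hlpos x hx), (min_le_left _ _).trans (hub x hx).2⟩
  have hlg : ∀ x, HasGradientAt l (-(K • x0)) x := by
    intro x
    rw [hasGradientAt_iff_hasFDerivAt]
    have h1 : HasFDerivAt (fun z : E2 => ⟪x0, z⟫) (innerSL ℝ x0) x :=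
      (innerSL ℝ x0).hasFDerivAt
    have h2 := (h1.const_sub 1).const_mul K
    convert! h2 using 1
    ext z
    simp
  have hgn : ‖-(K • x0)‖ = K := by
    rw [norm_neg, norm_smul, hx0, Real.norm_of_nonneg hKpos.le, mul_one]
  -- tangent disk
  have htan : ∀ z : E2, (1 - ⟪b 0, z⟫) ^ 2 + ⟪b 1, z⟫ ^ 2 < 2 * t * (1 - ⟪b 0, z⟫) →
      1 - ⟪b 0, z⟫ ≤ 4 * h →
      z ∈ Metric.ball (0 : E2) 1 ∧ |u z - L| ≤ 2 * t * L := by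
    intro z hz hzh
    have hXpos : 0 < 1 - ⟪b 0, z⟫ := by
      have h1 : 0 < (2 * t) * (1 - ⟪b 0, z⟫) := by
        linarith [sq_nonneg (1 - ⟪b 0, z⟫), sq_nonneg ⟪b 1, z⟫]
      exact pos_of_mul_pos_right h1 (by linarith)
    have hzD : z ∈ Metric.ball (0 : E2) 1 := by
      rw [mem_ball_zero_iff]
      have h1 : 0 < (1 - t) * (1 - ⟪b 0, z⟫) := mul_pos (by linarith) hXpos
      have h2 : ‖z‖ ^ 2 < 1 ^ 2 := by rw [hnorm z]; linarith
      exact lt_of_pow_lt_pow_left₀ 2 zero_le_one h2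
    refine ⟨hzD, ?_⟩
    have h1 : u z ≤ (1 + t) * L := by
      apply hup z (Metric.ball_subset_closedBall hzD)
      apply lt_of_pow_lt_pow_left₀ 2 hρ.le
      rw [hnx]
      have h1 : t * (1 - ⟪b 0, z⟫) ≤ t * (4 * h) := mul_le_mul_of_nonneg_left hzh htpos.le
      linarith
    have h2 := hlow z (by
      have e : ‖z - (1 - t) • x0‖ ^ 2 = (t - (1 - ⟪b 0, z⟫)) ^ 2 + ⟪b 1, z⟫ ^ 2 := by
        rw [hnorm, inner_sub_right, inner_sub_right, inner_smul_right, inner_smul_right,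
          hb1x, hb0, hip]
        ring
      have e2 : ‖z - (1 - t) • x0‖ < t := by
        apply lt_of_pow_lt_pow_left₀ 2 htpos.le
        rw [e]; linarith
      rw [norm_smul, norm_inv, Real.norm_of_nonneg htpos.le, inv_mul_lt_iff₀ htpos]
      simpa using e2)
    rw [abs_le]
    constructor <;> nlinarith [mul_pos htpos hLpos, mul_pos htpos (mul_pos htpos hLpos)]
  -- the rectangles
  set B : Set E2 := {z : E2 | ⟪b 0, z⟫ ∈ Icc (1 - 3 * h) (1 - 2 * h) ∧ ⟪b 1, z⟫ ∈ Icc (-w0) w0}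
    with hB
  set R : Set E2 := {z : E2 | ⟪b 0, z⟫ ∈ Icc (1 - 8 * m * h) 1 ∧ ⟪b 1, z⟫ ∈ Icc (-(4 * q)) (4 * q)}
    with hR
  have hBball : ∀ z ∈ B, ∀ w ∈ Metric.ball z h,
      w ∈ Metric.ball (0 : E2) 1 ∧ |u w - L| ≤ 2 * t * L := by
    rintro z ⟨⟨h1, h2⟩, h3, h4⟩ w hw
    rw [mem_ball_iff_norm] at hw
    have hX : |⟪b 0, w⟫ - ⟪b 0, z⟫| < h := by
      rw [← inner_sub_right]
      refine (abs_real_inner_le_norm _ _).trans_lt ?_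
      simpa using hw
    have hY : |⟪b 1, w⟫ - ⟪b 1, z⟫| < h := by
      rw [← inner_sub_right]
      refine (abs_real_inner_le_norm _ _).trans_lt ?_
      simpa using hw
    rw [abs_lt] at hX hY
    have hx1 : h < 1 - ⟪b 0, w⟫ := by linarith
    have hx2 : 1 - ⟪b 0, w⟫ ≤ 4 * h := by linarith
    refine htan w ?_ hx2
    have hy : ⟪b 1, w⟫ ^ 2 ≤ (w0 + h) ^ 2 := by
      apply sq_le_sq'
      · linarith
      · linarith
    have hx3 : (1 - ⟪b 0, w⟫) ^ 2 ≤ (4 * h) ^ 2 := by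
      apply sq_le_sq'
      · linarith
      · linarith
    have hhh : h * h ≤ t * h / 100 := by nlinarith
    nlinarith [sq_nonneg (w0 - h), mul_pos htpos hh, mul_lt_mul_of_pos_left hx1 htpos]
  have hBA : ∀ z ∈ B, z ∈ Metric.ball (0 : E2) 1 ∧ l z < u z := by
    intro z hz
    obtain ⟨h1, h2⟩ := hBball z hz z (Metric.mem_ball_self hh)
    refine ⟨h1, ?_⟩
    have h3 : l z ≤ K * (3 * h) := by
      have := hz.1.1
      rw [hb0] at this
      exact mul_le_mul_of_nonneg_left (by linarith) hKpos.le
    have h4 := (abs_le.1 h2).1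
    nlinarith
  have hAR : ∀ z, z ∈ Metric.ball (0 : E2) 1 → l z < u z → z ∈ R := by
    intro z hz hlz
    have hzD := Metric.ball_subset_closedBall hz
    have h1 : K * (1 - ⟪b 0, z⟫) < M := by
      rw [hb0]; exact hlz.trans_le (hub z hzD).2
    have h2 : 1 - ⟪b 0, z⟫ < 8 * m * h := by
      have : K * (8 * m * h) = M := by
        rw [← hmL]; linear_combination 8 * m * hKh
      rw [← this] at h1
      exact lt_of_mul_lt_mul_left h1 hKpos.le
    have h3 := hlpos z hzD
    have h4 : 0 ≤ 1 - ⟪b 0, z⟫ := by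
      rw [hb0]; exact nonneg_of_mul_nonneg_right h3 hKpos
    rw [mem_ball_zero_iff] at hz
    have h5 : ‖z‖ ^ 2 < 1 := by nlinarith [norm_nonneg z]
    rw [hnorm] at h5
    have h6 : ⟪b 1, z⟫ ^ 2 ≤ (4 * q) ^ 2 := by nlinarith
    have h7 := abs_le.1 (abs_le_of_sq_le_sq h6 (by positivity))
    exact ⟨⟨by linarith, by linarith⟩, h7.1, h7.2⟩
  have hvB : volume.real B = h * (2 * w0) := by
    rw [Measure.real, hB, volume_rect, ← ENNReal.ofReal_mul (by linarith),
      ENNReal.toReal_ofReal (by nlinarith)]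
    ring
  have hvR : volume.real R = 8 * m * h * (8 * q) := by
    rw [Measure.real, hR, volume_rect, ← ENNReal.ofReal_mul (by nlinarith),
      ENNReal.toReal_ofReal (by ring_nf; positivity)]
    ring
  have hRfin : volume R ≠ ⊤ := by
    rw [hR, volume_rect]; exact ENNReal.mul_ne_top ENNReal.ofReal_ne_top ENNReal.ofReal_ne_top
  have hα : ∀ z ∈ B, 1 / (1 + (8 * t * L / h) ^ 2) ≤ 1 / (1 + ‖gradient u z‖ ^ 2) := by
    intro z hz
    have h1 := grad_bound (c := L) (m := 2 * t * L) hh (by positivity)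
      (hu.subset (fun w hw => Metric.ball_subset_closedBall (hBball z hz w hw).1) (convex_ball _ _))
      (fun w hw => (hBball z hz w hw).2)
    have h2 : ‖gradient u z‖ ≤ 8 * t * L / h := h1.trans (le_of_eq (by ring))
    gcongr
  have hfin := compare hu hub hvc hvb hv hlg B R (rect_measurable b _ _ _ _) hBA hAR hRfin _ hα
    (hmin v hvc hvb)
  rw [hvB, hvR, hgn, hw0, hK] at hfin
  have e1 : 1 / (1 + (8 * t * L / h) ^ 2) ≥ h ^ 2 / (65 * t ^ 2 * L ^ 2) := by
    rw [ge_iff_le, div_le_div_iff₀ (by positivity) (by positivity)]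
    have e : h ^ 2 * (1 + (8 * t * L / h) ^ 2) = h ^ 2 + 64 * t ^ 2 * L ^ 2 := by
      field_simp; ring
    rw [e]
    nlinarith [pow_le_pow_left₀ hh.le hhL 2]
  have e2 : 1 / (1 + (L / (8 * h)) ^ 2) ≤ 64 * h ^ 2 / L ^ 2 := by
    rw [div_le_div_iff₀ (by positivity) (by positivity)]
    have e : 64 * h ^ 2 * (1 + (L / (8 * h)) ^ 2) = 64 * h ^ 2 + L ^ 2 := by
      field_simp; ring
    rw [e]
    nlinarith [sq_nonneg h]
  have e3 : h * (2 * (q / (200 * m))) * (h ^ 2 / (65 * t ^ 2 * L ^ 2)) ≤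
      8 * m * h * (8 * q) * (64 * h ^ 2 / L ^ 2) :=
    (mul_le_mul_of_nonneg_left e1 (by positivity)).trans
      (hfin.trans (mul_le_mul_of_nonneg_left e2 (by positivity)))
  have e4 : h * (2 * (q / (200 * m))) * (h ^ 2 / (65 * t ^ 2 * L ^ 2)) =
      (1000000 / 65) * (m * h ^ 3 * q / L ^ 2) := by
    rw [ht]; field_simp; norm_num
  have e5 : 8 * m * h * (8 * q) * (64 * h ^ 2 / L ^ 2) = 4096 * (m * h ^ 3 * q / L ^ 2) := by
    field_simp; norm_num
  rw [e4, e5] at e3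
  have e6 : 0 < m * h ^ 3 * q / L ^ 2 := by positivity
  linarith
end
end

section
/- Let f : ℝ² → ℝ be a positive continuous function of the form f(x) = c|x|^{−α}(1 + o(1)) as |x| → ∞, with constants c > 0 and α > 1. Then f satisfies Condition (A). -/
noncomputable section

open MeasureTheory Set Filter
open scoped RealInnerProductSpace Topology

/-- A positive continuous `f` with `f(x) = c|x|^{-α}(1 + o(1))` as `|x| → ∞`
(that is, `|x|^α f(x) → c`) with `c > 0` and `α > 1` satisfies Condition (A). -/
theorem condA_of_power_decay
    (f : E2 → ℝ) (hfpos : ∀ x, 0 < f x) (hfcont : Continuous f)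
    (c α : ℝ) (hc : 0 < c) (hα : 1 < α)
    (hasymp : Tendsto (fun x : E2 => ‖x‖ ^ α * f x)
      (comap (fun x : E2 => ‖x‖) atTop) (𝓝 c)) :
    CondA f := by
  obtain ⟨R, hR1, hRlo, hRhi⟩ : ∃ R : ℝ, 1 ≤ R ∧ (∀ x : E2, R ≤ ‖x‖ → c / 2 ≤ ‖x‖ ^ α * f x) ∧
      (∀ x : E2, R ≤ ‖x‖ → ‖x‖ ^ α * f x ≤ 2 * c) := by
    have h := hasymp.eventually (Icc_mem_nhds (show c / 2 < c by linarith)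
      (show c < 2 * c by linarith))
    rw [eventually_comap] at h
    obtain ⟨R, hR⟩ := eventually_atTop.1 h
    refine ⟨max 1 R, le_max_left _ _, ?_, ?_⟩
    · intro x hx
      exact (hR ‖x‖ (le_trans (le_max_right _ _) hx) x rfl).1
    · intro x hx
      exact (hR ‖x‖ (le_trans (le_max_right _ _) hx) x rfl).2
  obtain ⟨a, ha, hlo⟩ : ∃ a : ℝ, 0 < a ∧ ∀ x : E2, a ≤ (1 + ‖x‖) ^ α * f x := by
    obtain ⟨x0, -, hx0⟩ := (isCompact_closedBall (0 : E2) R).exists_isMinOn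
      ⟨0, by simp; linarith⟩ hfcont.continuousOn
    refine ⟨min (c / 2) (f x0), lt_min (by linarith) (hfpos x0), fun x => ?_⟩
    rcases le_total R ‖x‖ with h | h
    · refine (min_le_left _ _).trans ((hRlo x h).trans ?_)
      refine mul_le_mul_of_nonneg_right ?_ (hfpos x).le
      exact Real.rpow_le_rpow (norm_nonneg _) (by linarith) (by linarith)
    · have h1 : f x0 ≤ f x := hx0 (by simpa using h)
      have h2 : 1 ≤ (1 + ‖x‖) ^ α :=
        Real.one_le_rpow (by linarith [norm_nonneg x]) (by linarith)
      refine (min_le_right _ _).trans (h1.trans ?_)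
      exact le_mul_of_one_le_left (hfpos x).le h2
  intro N hN
  have hb : 0 < a / (2 * c * N) := by positivity
  have hβ : 0 < α - 1 := by linarith
  have hRpos : 0 < R := by linarith
  refine ⟨min (1 / R) ((a / (2 * c * N)) ^ (1 / (α - 1))),
    lt_min (by positivity) (Real.rpow_pos_of_pos hb _), fun x y hxy => ?_⟩
  have hx := norm_nonneg x
  have hy := norm_nonneg y
  have hX : 0 < 1 + ‖x‖ := by linarith
  have h1 : 1 + ‖x‖ < 1 / R * ‖y‖ :=
    hxy.trans_le (mul_le_mul_of_nonneg_right (min_le_left _ _) hy)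
  have h2 : 1 + ‖x‖ < (a / (2 * c * N)) ^ (1 / (α - 1)) * ‖y‖ :=
    hxy.trans_le (mul_le_mul_of_nonneg_right (min_le_right _ _) hy)
  have hyR : R ≤ ‖y‖ := by
    have h3 : 1 < ‖y‖ / R := by
      have : 1 / R * ‖y‖ = ‖y‖ / R := by ring
      linarith
    rw [lt_div_iff₀ hRpos] at h3
    linarith
  have hY : 0 < ‖y‖ := by linarith
  have h4 := Real.rpow_lt_rpow hX.le h2 hβ
  rw [Real.mul_rpow (Real.rpow_nonneg hb.le _) hy, ← Real.rpow_mul hb.le,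
    one_div_mul_cancel hβ.ne', Real.rpow_one] at h4
  have e : ∀ t : ℝ, 0 < t → t ^ α = t * t ^ (α - 1) := by
    intro t ht
    rw [Real.rpow_sub_one ht.ne']
    field_simp
  have hfx := hlo x
  have hfy := hRhi y hyR
  rw [e _ hX] at hfx
  rw [e _ hY] at hfy
  have hp := Real.rpow_pos_of_pos hX (α - 1)
  have hq := Real.rpow_pos_of_pos hY (α - 1)
  generalize (1 + ‖x‖) ^ (α - 1) = p at *
  generalize ‖y‖ ^ (α - 1) = q at *
  rw [lt_div_iff₀ (mul_pos hY (hfpos y))]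
  have h5 : 2 * c * N * p < a * q := by
    have : a / (2 * c * N) * q = a * q / (2 * c * N) := by ring
    rw [this, lt_div_iff₀ (by positivity)] at h4
    linarith
  refine lt_of_mul_lt_mul_right (a := p * q) ?_ (by positivity)
  calc N * (‖y‖ * f y) * (p * q) = (‖y‖ * q * f y) * (N * p) := by ring
    _ ≤ 2 * c * (N * p) := mul_le_mul_of_nonneg_right hfy (by positivity)
    _ = 2 * c * N * p := by ring
    _ < a * q := h5
    _ ≤ ((1 + ‖x‖) * p * f x) * q := mul_le_mul_of_nonneg_right hfx hq.le
    _ = (1 + ‖x‖) * f x * (p * q) := by ring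
end
end

section
/- Let f satisfy Condition (A), let u : Ω → [0, M] be concave, and let x₀ ∈ ∂Ω have supporting line l and outward unit normal n. Suppose that for each sufficiently large k > 0 there is a convex body (compact convex set with nonempty interior) Ω̃_k ⊆ Ω_k such that: (i) (1/k)·sup{|∇u(x)| : x ∈ Ω̃_k, u differentiable at x} → 0 as k → +∞, and (ii) there is a constant c > 0 such that for all sufficiently large k and all differentiability points x ∈ Ω̃_k, (|Ω̃_k|/|Ω_k|) · k/(1 + |∇u(x)|) ≥ c. Then for all sufficiently large k, ∫_{Ω_k} f(∇u(x)) dx − f(−k n)·|Ω_k| > 0; consequently F(u^(k)) < F(u), so u is not a minimizer of F over C_M. -/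
noncomputable section

open MeasureTheory Set Filter
open scoped RealInnerProductSpace Topology

/-- The truncated function `u^(k)(x) = min{u(x), k⟨x₀ − x, n⟩}`. -/
def trunc (u : E2 → ℝ) (x₀ n : E2) (k : ℝ) : E2 → ℝ :=
  fun x => min (u x) (k * ⟪x₀ - x, n⟫)

/-- The set `Ω_k = {x ∈ Ω : u(x) ≥ k⟨x₀ − x, n⟩}`. -/
def Omk (Ω : Set E2) (u : E2 → ℝ) (x₀ n : E2) (k : ℝ) : Set E2 :=
  {x ∈ Ω | k * ⟪x₀ - x, n⟫ ≤ u x}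

lemma aux_ae_diff (Ω : Set E2) (u : E2 → ℝ) (hu : ConcaveOn ℝ Ω u) :
    ∀ᵐ x : E2, x ∈ Ω → DifferentiableAt ℝ u x := by
  have h1 : ∀ᵐ x : E2, x ∉ frontier Ω := measure_eq_zero_iff_ae_notMem.1 (hu.1.addHaar_frontier volume)
  have h2 : volume {x | x ∈ interior Ω ∧ ¬ DifferentiableAt ℝ u x} = 0 := by
    apply measure_null_of_locally_null
    rintro x ⟨hx, -⟩
    obtain ⟨C, t, ht, hL⟩ := hu.locallyLipschitzOn_interior hx
    rw [isOpen_interior.nhdsWithin_eq hx] at ht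
    refine ⟨interior t ∩ {x | ¬ DifferentiableAt ℝ u x}, ?_, ?_⟩
    · rw [mem_nhdsWithin]
      exact ⟨interior t, isOpen_interior, mem_interior_iff_mem_nhds.2 ht, fun y hy => ⟨hy.1, hy.2.2⟩⟩
    · have := (hL.mono interior_subset).ae_differentiableWithinAt_of_mem (μ := volume)
      rw [measure_eq_zero_iff_ae_notMem]
      filter_upwards [this] with y hy hyy
      exact hyy.2 ((hy hyy.1).differentiableAt (isOpen_interior.mem_nhds hyy.1))
  rw [measure_eq_zero_iff_ae_notMem] at h2
  filter_upwards [h1, h2] with x hx1 hx2 hx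
  by_contra hd
  apply hx2
  refine ⟨?_, hd⟩
  by_contra hi
  exact hx1 ⟨subset_closure hx, hi⟩

lemma aux_bdd (f : E2 → ℝ) (hfpos : ∀ x, 0 < f x) (hfcont : Continuous f) (hA : CondA f) :
    ∃ B, ∀ x, f x ≤ B := by
  obtain ⟨δ, hδ, h⟩ := hA 1 one_pos
  obtain ⟨B, hB⟩ := (isCompact_closedBall (0 : E2) (1 + 1 / δ)).bddAbove_image hfcont.continuousOn
  refine ⟨max B (f 0), fun x => ?_⟩
  by_cases hx : ‖x‖ ≤ 1 + 1 / δ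
  · exact le_max_of_le_left (hB ⟨x, by simpa using hx, rfl⟩)
  · push Not at hx
    apply le_max_of_le_right
    have h3 : 1 < δ * ‖x‖ := by
      have := mul_lt_mul_of_pos_left hx hδ
      have h4 : δ * (1 + 1 / δ) = δ + 1 := by field_simp
      linarith
    have h4 := h 0 x (by simpa using h3)
    have h5 : 1 < ‖x‖ := by
      have : 0 < 1 / δ := by positivity
      linarith
    have := hfpos x
    rw [lt_div_iff₀ (by positivity)] at h4
    simp at h4
    nlinarith

lemma aux_grad (v w : E2 → ℝ) (x : E2) (h : ∀ y, v y ≤ w y) (hx : v x = w x)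
    (hv : DifferentiableAt ℝ v x) (hw : DifferentiableAt ℝ w x) :
    gradient v x = gradient w x := by
  have hm : IsLocalMin (fun y => w y - v y) x := by
    refine Eventually.of_forall fun y => ?_
    simp only [hx, sub_self]
    linarith [h y]
  have := hm.fderiv_eq_zero
  rw [fderiv_fun_sub hw hv, sub_eq_zero] at this
  simp [gradient, this]

lemma aux_meas (v : E2 → ℝ) : Measurable (gradient v) := by
  unfold gradient
  exact (LinearIsometryEquiv.continuous _).measurable.comp (measurable_fderiv ℝ v)

lemma aux_int (Ω : Set E2) (hΩ : volume Ω ≠ ⊤) (f : E2 → ℝ) (hfpos : ∀ x, 0 < f x)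
    (hfcont : Continuous f) (hA : CondA f) (v : E2 → ℝ) :
    IntegrableOn (fun x => f (gradient v x)) Ω := by
  obtain ⟨B, hB⟩ := aux_bdd f hfpos hfcont hA
  refine Measure.integrableOn_of_bounded (M := B) hΩ
    (hfcont.measurable.comp (aux_meas v)).aestronglyMeasurable ?_
  refine Eventually.of_forall fun x => ?_
  rw [Real.norm_of_nonneg (hfpos _).le]
  exact hB _

lemma aux_lin (x₀ n : E2) (k : ℝ) (x : E2) :
    HasGradientAt (fun y : E2 => k * ⟪x₀ - y, n⟫) (-(k • n)) x := by
  rw [hasGradientAt_iff_hasFDerivAt]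
  have h : HasFDerivAt (fun y : E2 => k * ⟪x₀, n⟫ + InnerProductSpace.toDual ℝ E2 (-(k • n)) y)
      (InnerProductSpace.toDual ℝ E2 (-(k • n))) x :=
    (ContinuousLinearMap.hasFDerivAt _).const_add _
  have e : (fun y : E2 => k * ⟪x₀ - y, n⟫) =
      (fun y : E2 => k * ⟪x₀, n⟫ + InnerProductSpace.toDual ℝ E2 (-(k • n)) y) := by
    funext y
    rw [InnerProductSpace.toDual_apply_apply, inner_sub_left, inner_neg_left, real_inner_smul_left,
      real_inner_comm y n]
    ring
  rw [e]
  exact h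

lemma aux_linconv (Ω : Set E2) (hΩ : Convex ℝ Ω) (x₀ n : E2) (k : ℝ) :
    ConcaveOn ℝ Ω (fun y : E2 => k * ⟪x₀ - y, n⟫) ∧
    ConvexOn ℝ Ω (fun y : E2 => k * ⟪x₀ - y, n⟫) := by
  refine ⟨⟨hΩ, ?_⟩, ⟨hΩ, ?_⟩⟩ <;>
  · intro x _ y _ a b _ _ hab
    apply le_of_eq
    obtain rfl : b = 1 - a := by linarith
    simp [inner_sub_left, inner_add_left, inner_smul_left]
    ring

lemma aux_conv (Ω : Set E2) (u : E2 → ℝ) (hu : ConcaveOn ℝ Ω u) (x₀ n : E2) (k : ℝ) :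
    Convex ℝ (Omk Ω u x₀ n k) ∧ ConcaveOn ℝ Ω (trunc u x₀ n k) := by
  obtain ⟨h1, h2⟩ := aux_linconv Ω hu.1 x₀ n k
  constructor
  · have := (h2.sub hu).convex_le 0
    convert this using 1
    ext x
    simp [Omk]
  · exact hu.inf h1

lemma aux_key (Ω : Set E2) (hΩ : IsConvexBody Ω)
    (f : E2 → ℝ) (hfpos : ∀ x, 0 < f x) (hfcont : Continuous f) (hA : CondA f)
    (x₀ n : E2) (u : E2 → ℝ) (hu : ConcaveOn ℝ Ω u) (k : ℝ) :
    ∫ x in Ω, f (gradient u x) - f (gradient (trunc u x₀ n k) x) =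
      (∫ x in Omk Ω u x₀ n k, f (gradient u x)) -
            f (-(k • n)) * (volume (Omk Ω u x₀ n k)).toReal := by
  obtain ⟨hc, ht⟩ := aux_conv Ω u hu x₀ n k
  have hfin : volume Ω ≠ ⊤ := hΩ.1.measure_ne_top
  have hsub : Omk Ω u x₀ n k ⊆ Ω := fun x hx => hx.1
  have hmO := hc.nullMeasurableSet volume
  have hfinO : volume (Omk Ω u x₀ n k) ≠ ⊤ := measure_ne_top_of_subset hsub hfin
  have i1 := aux_int Ω hfin f hfpos hfcont hA u
  have i2 := aux_int Ω hfin f hfpos hfcont hA (trunc u x₀ n k)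
  have d1 := aux_ae_diff Ω u hu
  have d2 := aux_ae_diff Ω _ ht
  have hO : ∀ᵐ x, x ∈ Omk Ω u x₀ n k → gradient (trunc u x₀ n k) x = -(k • n) := by
    filter_upwards [d2] with x h2 hx
    rw [← (aux_lin x₀ n k x).gradient]
    exact aux_grad _ _ x (fun y => min_le_right _ _) (min_eq_right hx.2) (h2 hx.1)
      (aux_lin x₀ n k x).differentiableAt
  have hD : ∀ᵐ x, x ∈ Ω \ Omk Ω u x₀ n k → gradient (trunc u x₀ n k) x = gradient u x := by
    filter_upwards [d1, d2] with x h1 h2 hx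
    refine aux_grad _ _ x (fun y => min_le_left _ _) (min_eq_left ?_) (h2 hx.1) (h1 hx.1)
    by_contra hh
    exact hx.2 ⟨hx.1, (not_le.1 hh).le⟩
  have i3 : IntegrableOn (fun x => f (gradient u x) - f (gradient (trunc u x₀ n k) x)) Ω :=
    i1.sub i2
  rw [← integral_inter_add_sdiff₀ hmO i3, inter_eq_right.2 hsub]
  have e1 : ∫ x in Ω \ Omk Ω u x₀ n k, f (gradient u x) - f (gradient (trunc u x₀ n k) x) = 0 := by
    apply integral_eq_zero_of_ae
    rw [EventuallyEq, ae_restrict_iff'₀ (hΩ.1.measurableSet.nullMeasurableSet.diff hmO)]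
    filter_upwards [hD] with x hx hxx
    rw [hx hxx]
    simp
  have e2 : ∫ x in Omk Ω u x₀ n k, f (gradient u x) - f (gradient (trunc u x₀ n k) x) =
     ∫ x in Omk Ω u x₀ n k, f (gradient u x) - f (-(k • n)) := by
    apply integral_congr_ae
    rw [EventuallyEq, ae_restrict_iff'₀ hmO]
    filter_upwards [hO] with x hx hxx
    rw [hx hxx]
  rw [e1, e2, integral_sub (i1.mono_set hsub) (integrableOn_const hfinO)]
  simp [Measure.real, mul_comm]

/-- If there is a family of convex bodies `Ω̃_k ⊆ Ω_k` such that
(i) `(1/k)·sup_{Ω̃_k} |∇u| → 0` and (ii) `(|Ω̃_k|/|Ω_k|)·k/(1+|∇u|) ≥ c > 0`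
on `Ω̃_k` for large `k`, then for all large `k` the truncation strictly
decreases the resistance, and `u` is not a minimizer. -/
theorem not_minimizer_of_good_family
    (Ω : Set E2) (hΩ : IsConvexBody Ω) (M : ℝ) (hM : 0 < M)
    (f : E2 → ℝ) (hfpos : ∀ x, 0 < f x) (hfcont : Continuous f) (hA : CondA f)
    (x₀ n : E2) (hx₀ : x₀ ∈ frontier Ω) (hn : IsSupportNormal Ω x₀ n)
    (u : E2 → ℝ) (hu : ConcaveOn ℝ Ω u) (hub : ∀ x ∈ Ω, u x ∈ Icc 0 M)
    (Ωt : ℝ → Set E2) (K₀ : ℝ) (hK₀ : 0 < K₀)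
    (hΩt : ∀ k ≥ K₀, IsConvexBody (Ωt k) ∧ Ωt k ⊆ Omk Ω u x₀ n k)
    (hi : ∀ ε : ℝ, 0 < ε → ∃ K : ℝ, ∀ k ≥ K, ∀ x ∈ Ωt k,
      DifferentiableAt ℝ u x → ‖gradient u x‖ / k < ε)
    (hii : ∃ c : ℝ, 0 < c ∧ ∃ K : ℝ, ∀ k ≥ K, ∀ x ∈ Ωt k,
      DifferentiableAt ℝ u x →
        c ≤ (volume (Ωt k)).toReal / (volume (Omk Ω u x₀ n k)).toReal *
              (k / (1 + ‖gradient u x‖))) :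
    (∃ K : ℝ, ∀ k ≥ K,
      0 < (∫ x in Omk Ω u x₀ n k, f (gradient u x)) -
            f (-(k • n)) * (volume (Omk Ω u x₀ n k)).toReal ∧
      (∫ x in Ω, f (gradient (trunc u x₀ n k) x)) < ∫ x in Ω, f (gradient u x)) ∧
    ¬ (∀ v : E2 → ℝ, ConcaveOn ℝ Ω v → (∀ x ∈ Ω, v x ∈ Icc 0 M) →
        ∫ x in Ω, f (gradient u x) ≤ ∫ x in Ω, f (gradient v x)) := by
  obtain ⟨c, hc, K₁, hK₁⟩ := hii
  obtain ⟨δ, hδ, hN⟩ := hA (2 / c) (by positivity)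
  obtain ⟨K₂, hK₂⟩ := hi (δ / 2) (by positivity)
  have hfin : volume Ω ≠ ⊤ := hΩ.1.measure_ne_top
  have main : ∀ k ≥ max (max K₀ K₁) (max K₂ (2 / δ + 1)),
      0 < (∫ x in Omk Ω u x₀ n k, f (gradient u x)) -
            f (-(k • n)) * (volume (Omk Ω u x₀ n k)).toReal ∧
      (∫ x in Ω, f (gradient (trunc u x₀ n k) x)) < ∫ x in Ω, f (gradient u x) := by
    intro k hk
    simp only [ge_iff_le, max_le_iff] at hk
    obtain ⟨⟨hk0, hk1⟩, hk2, hk3⟩ := hk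
    have hkpos : 0 < k := hK₀.trans_le hk0
    obtain ⟨hb, hsub⟩ := hΩt k hk0
    have hsubΩ : Omk Ω u x₀ n k ⊆ Ω := fun x hx => hx.1
    have hfinO : volume (Omk Ω u x₀ n k) ≠ ⊤ := measure_ne_top_of_subset hsubΩ hfin
    have hfint : volume (Ωt k) ≠ ⊤ := measure_ne_top_of_subset hsub hfinO
    have hpt : 0 < volume (Ωt k) := Measure.measure_pos_of_nonempty_interior _ hb.2.2
    have hT : 0 < (volume (Ωt k)).toReal := ENNReal.toReal_pos hpt.ne' hfint
    have hO : 0 < (volume (Omk Ω u x₀ n k)).toReal :=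
      ENNReal.toReal_pos (hpt.trans_le (measure_mono hsub)).ne' hfinO
    set T := (volume (Ωt k)).toReal with hTdef
    set O := (volume (Omk Ω u x₀ n k)).toReal with hOdef
    have hfk := hfpos (-(k • n))
    have iO := aux_int _ hfinO f hfpos hfcont hA u
    have hpoint : ∀ᵐ x, x ∈ Ωt k → 2 * f (-(k • n)) * O / T ≤ f (gradient u x) := by
      filter_upwards [aux_ae_diff Ω u hu] with x hd hx
      have hdx := hd (hsubΩ (hsub hx))
      have a1 := hK₁ k hk1 x hx hdx
      have a2 := hK₂ k hk2 x hx hdx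
      have hnk : ‖-(k • n)‖ = k := by
        rw [norm_neg, norm_smul, hn.1, mul_one, Real.norm_of_nonneg hkpos.le]
      have a3 := hN (gradient u x) (-(k • n)) (by
        rw [hnk]
        rw [div_lt_iff₀ hkpos] at a2
        have : 1 < δ / 2 * k := by
          have h5 : 2 / δ < k := by linarith
          rw [div_lt_iff₀ hδ] at h5
          linarith
        linarith)
      rw [hnk] at a3
      have hg : 0 < 1 + ‖gradient u x‖ := by positivity
      set g := 1 + ‖gradient u x‖ with hgdef
      rw [lt_div_iff₀ (by positivity), div_mul_eq_mul_div, div_lt_iff₀ hc] at a3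
      rw [div_mul_div_comm, le_div_iff₀ (by positivity)] at a1
      rw [div_le_iff₀ hT]
      have h6 : 2 * f (-(k • n)) * O * (c * g) ≤ f (gradient u x) * T * (c * g) := by
        have e1 := mul_le_mul_of_nonneg_left a1 (by positivity : 0 ≤ 2 * f (-(k • n)))
        have e2 := mul_le_mul_of_nonneg_left a3.le hT.le
        calc _ = 2 * f (-(k • n)) * (c * (O * g)) := by ring
          _ ≤ _ := e1
          _ = T * (2 * (k * f (-(k • n)))) := by ring
          _ ≤ _ := e2
          _ = _ := by ring
      exact le_of_mul_le_mul_right h6 (by positivity)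
    have first : 0 < (∫ x in Omk Ω u x₀ n k, f (gradient u x)) - f (-(k • n)) * O := by
      have b1 : ∫ x in Ωt k, f (gradient u x) ≤ ∫ x in Omk Ω u x₀ n k, f (gradient u x) :=
        setIntegral_mono_set iO (Eventually.of_forall fun x => (hfpos _).le) hsub.eventuallyLE
      have b2 : ∫ x in Ωt k, 2 * f (-(k • n)) * O / T ≤ ∫ x in Ωt k, f (gradient u x) := by
        have i4 : IntegrableOn (fun _ : E2 => 2 * f (-(k • n)) * O / T) (Ωt k) :=
          integrableOn_const hfint
        refine integral_mono_ae i4 (iO.mono_set hsub) ?_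
        rw [EventuallyLE, ae_restrict_iff' hb.1.measurableSet]
        exact hpoint
      rw [setIntegral_const, Measure.real, ← hTdef, smul_eq_mul, mul_div_cancel₀ _ hT.ne'] at b2
      have : 0 < f (-(k • n)) * O := by positivity
      linarith
    refine ⟨first, ?_⟩
    rw [hOdef, ← aux_key Ω hΩ f hfpos hfcont hA x₀ n u hu k,
      integral_sub (aux_int Ω hfin f hfpos hfcont hA u) (aux_int Ω hfin f hfpos hfcont hA _)] at first
    linarith
  refine ⟨⟨_, main⟩, fun hmin => ?_⟩
  set k := max (max K₀ K₁) (max K₂ (2 / δ + 1)) with hkdef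
  have hk0 : 0 ≤ k := hK₀.le.trans ((le_max_left _ _).trans (le_max_left _ _))
  refine absurd (main k le_rfl).2 (not_lt.2 (hmin _ (aux_conv Ω u hu x₀ n k).2 fun x hx => ?_))
  exact ⟨le_min (hub x hx).1 (mul_nonneg hk0 (hn.2 x hx)), (min_le_left _ _).trans (hub x hx).2⟩
end
end

section
/- Let u : Ω → [0, M] be concave and upper semicontinuous, and let x₀ ∈ ∂Ω have supporting line l and outward unit normal n. Assume z₀ := u(x₀) = max{u(x) : x ∈ l ∩ ∂Ω} > 0. Then the sets Ω_k are nested (Ω_{k₁} ⊆ Ω_{k₂} whenever k₁ ≥ k₂), the function k ↦ α_k := sup_{x ∈ Ω_k} u(x) − z₀ is monotone nonincreasing and nonnegative, and α_k → 0 as k → +∞. -/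
noncomputable section

open MeasureTheory Set Filter
open scoped RealInnerProductSpace Topology

/-- The sets `Ω_k` are nested, and `α_k = sup_{Ω_k} u − z₀` is nonincreasing,
nonnegative, and tends to `0` as `k → +∞`. -/
theorem alpha_tendsto_zero
    (Ω : Set E2) (hΩ : IsConvexBody Ω) (M : ℝ) (hM : 0 < M)
    (x₀ n : E2) (hx₀ : x₀ ∈ frontier Ω) (hn : IsSupportNormal Ω x₀ n)
    (u : E2 → ℝ) (hu : ConcaveOn ℝ Ω u) (hub : ∀ x ∈ Ω, u x ∈ Icc 0 M)
    (husc : UpperSemicontinuousOn u Ω)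
    (hz : 0 < u x₀)
    (hmax : ∀ x ∈ {y : E2 | ⟪x₀ - y, n⟫ = 0} ∩ frontier Ω, u x ≤ u x₀) :
    (∀ k₁ k₂ : ℝ, 0 < k₂ → k₂ ≤ k₁ → Omk Ω u x₀ n k₁ ⊆ Omk Ω u x₀ n k₂) ∧
    (∀ k₁ k₂ : ℝ, 0 < k₂ → k₂ ≤ k₁ →
      sSup (u '' Omk Ω u x₀ n k₁) - u x₀ ≤ sSup (u '' Omk Ω u x₀ n k₂) - u x₀) ∧
    (∀ k : ℝ, 0 < k → 0 ≤ sSup (u '' Omk Ω u x₀ n k) - u x₀) ∧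
    Tendsto (fun k : ℝ => sSup (u '' Omk Ω u x₀ n k) - u x₀) atTop (𝓝 0) := by
  obtain ⟨hc, hconv, -⟩ := hΩ
  obtain ⟨hn1, hn2⟩ := hn
  have hx₀Ω : x₀ ∈ Ω := hc.isClosed.frontier_subset hx₀
  have hbdd : ∀ k, BddAbove (u '' Omk Ω u x₀ n k) := by
    intro k
    refine ⟨M, ?_⟩
    rintro _ ⟨x, hx, rfl⟩
    exact (hub x hx.1).2
  have hmem : ∀ k, u x₀ ∈ u '' Omk Ω u x₀ n k := by
    intro k
    refine ⟨x₀, ⟨hx₀Ω, ?_⟩, rfl⟩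
    simpa using hz.le
  have hnest : ∀ k₁ k₂ : ℝ, 0 < k₂ → k₂ ≤ k₁ → Omk Ω u x₀ n k₁ ⊆ Omk Ω u x₀ n k₂ := by
    intro k₁ k₂ _ h x hx
    exact ⟨hx.1, (mul_le_mul_of_nonneg_right h (hn2 x hx.1)).trans hx.2⟩
  have hnonneg : ∀ k : ℝ, 0 ≤ sSup (u '' Omk Ω u x₀ n k) - u x₀ := by
    intro k
    exact sub_nonneg.2 (le_csSup (hbdd k) (hmem k))
  -- on the supporting line `u` is at most `u x₀`
  have hline : ∀ x ∈ Ω, ⟪x₀ - x, n⟫ = 0 → u x ≤ u x₀ := by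
    intro x hx h0
    refine hmax x ⟨h0, ?_⟩
    rw [hc.isClosed.frontier_eq]
    refine ⟨hx, fun hint => ?_⟩
    obtain ⟨ε, hε, hb⟩ := Metric.mem_nhds_iff.1 (mem_interior_iff_mem_nhds.1 hint)
    have hy : x + (ε / 2) • n ∈ Ω := by
      apply hb
      rw [Metric.mem_ball, dist_eq_norm, add_sub_cancel_left, norm_smul, hn1, mul_one,
        Real.norm_of_nonneg (by positivity)]
      linarith
    have h1 := hn2 _ hy
    rw [← sub_sub, inner_sub_left, h0, inner_smul_left, real_inner_self_eq_norm_sq, hn1] at h1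
    simp at h1
    linarith
  refine ⟨hnest, ?_, fun k _ => hnonneg k, ?_⟩
  · intro k₁ k₂ h h'
    exact sub_le_sub_right
      (csSup_le_csSup (hbdd k₂) ⟨_, hmem k₁⟩ (image_mono (hnest k₁ k₂ h h'))) _
  · rw [Metric.tendsto_atTop]
    intro ε hε
    have hK : IsCompact (Ω ∩ u ⁻¹' Ici (u x₀ + ε / 2)) := by
      obtain ⟨v, hv, hveq⟩ := upperSemicontinuousOn_iff_preimage_Ici.1 husc (u x₀ + ε / 2)
      rw [hveq]
      exact hc.inter_right hv
    have hδ : ∃ δ : ℝ, 0 < δ ∧ ∀ x ∈ Ω ∩ u ⁻¹' Ici (u x₀ + ε / 2), δ ≤ ⟪x₀ - x, n⟫ := by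
      rcases (Ω ∩ u ⁻¹' Ici (u x₀ + ε / 2)).eq_empty_or_nonempty with he | hne
      · exact ⟨1, one_pos, by simp [he]⟩
      · obtain ⟨y, hy, hmin⟩ := hK.exists_isMinOn hne
          (f := fun x => ⟪x₀ - x, n⟫) (by fun_prop)
        refine ⟨⟪x₀ - y, n⟫, lt_of_le_of_ne (hn2 y hy.1) fun h => ?_, fun x hx => hmin hx⟩
        have h1 := hline y hy.1 h.symm
        have h2 : u x₀ + ε / 2 ≤ u y := hy.2
        linarith
    obtain ⟨δ, hδ0, hδ⟩ := hδ
    refine ⟨M / δ + 1, fun k hk => ?_⟩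
    have hMk : M < k * δ := by
      rw [← div_lt_iff₀ hδ0]
      linarith
    have hk0 : 0 ≤ k := by
      have : 0 < M / δ := by positivity
      linarith
    have hle : sSup (u '' Omk Ω u x₀ n k) ≤ u x₀ + ε / 2 := by
      refine csSup_le ⟨_, hmem k⟩ ?_
      rintro _ ⟨x, hx, rfl⟩
      by_contra! hlt
      have h1 := hδ x ⟨hx.1, hlt.le⟩
      have h2 := mul_le_mul_of_nonneg_left h1 hk0
      have h3 := hx.2
      have h4 := (hub x hx.1).2
      linarith
    rw [Real.dist_eq, sub_zero, abs_of_nonneg (hnonneg k)]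
    linarith
end
end

section
/- Let u : Ω → [0, M] be concave and upper semicontinuous, and let x₀ ∈ ∂Ω be a regular point (unique supporting line l) with outward unit normal n. Assume z₀ := u(x₀) = max{u(x) : x ∈ l ∩ ∂Ω} > 0. For k > 0 the set ω_k := {⟨x₀ − x, n⟩ : x ∈ Ω_k} is a closed interval of the form [0, (z₀ + β_k)/k]; moreover β_k ≤ sup_{x ∈ Ω_k} u(x) − z₀ and β_k → 0 as k → +∞, i.e., k · sup_{x ∈ Ω_k} ⟨x₀ − x, n⟩ → z₀ as k → +∞. -/
noncomputable section

open MeasureTheory Set Filter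
open scoped RealInnerProductSpace Topology

theorem aux_closed (Ω : Set E2) (hc : IsCompact Ω) (u f : E2 → ℝ)
    (husc : UpperSemicontinuousOn u Ω) (hf : Continuous f) :
    IsCompact {x ∈ Ω | f x ≤ u x} := by
  refine hc.of_isClosed_subset ?_ (fun x hx => hx.1)
  rw [← closure_subset_iff_isClosed]
  intro x hx
  have hxΩ : x ∈ Ω := by
    have := closure_mono (fun y (hy : y ∈ {x ∈ Ω | f x ≤ u x}) => hy.1) hx
    rwa [hc.isClosed.closure_eq] at this
  refine ⟨hxΩ, ?_⟩
  by_contra! hlt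
  obtain ⟨q, h1, h2⟩ := exists_between hlt
  have e1 : ∀ᶠ y in 𝓝[Ω] x, u y < q := husc x hxΩ q h1
  have e2 : ∀ᶠ y in 𝓝 x, q < f y := hf.continuousAt.eventually (lt_mem_nhds h2)
  rw [eventually_nhdsWithin_iff] at e1
  obtain ⟨y, hy, hy1, hy2⟩ := ((mem_closure_iff_frequently.1 hx).and_eventually (e1.and e2)).exists
  have := hy1 hy.1
  have := hy.2
  linarith

theorem aux_interior (Ω : Set E2) (x₀ n : E2) (hn : IsSupportNormal Ω x₀ n)
    (y : E2) (hy : y ∈ interior Ω) : 0 < ⟪x₀ - y, n⟫ := by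
  have hcont : ContinuousAt (fun t : ℝ => y + t • n) 0 := by fun_prop
  have h0 : ∀ᶠ t : ℝ in 𝓝 0, y + t • n ∈ Ω := by
    apply hcont.eventually
    simpa using mem_interior_iff_mem_nhds.1 hy
  have h1 : ∀ᶠ t : ℝ in 𝓝[>] 0, y + t • n ∈ Ω := h0.filter_mono nhdsWithin_le_nhds
  obtain ⟨t, ht, ht0⟩ := (h1.and self_mem_nhdsWithin).exists
  have h2 := hn.2 _ ht
  have ht0' : 0 < t := ht0
  rw [← sub_sub, inner_sub_left, real_inner_smul_left, real_inner_self_eq_norm_sq, hn.1] at h2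
  linarith

/-- At a regular boundary point, the set `ω_k = {⟨x₀ − x, n⟩ : x ∈ Ω_k}` is a
closed interval `[0, (z₀ + β_k)/k]` with `β_k ≤ α_k`, and `β_k → 0`, i.e.
`k · sup_{x ∈ Ω_k} ⟨x₀ − x, n⟩ → z₀` as `k → +∞`. -/
theorem omega_k_interval
    (Ω : Set E2) (hΩ : IsConvexBody Ω) (M : ℝ) (hM : 0 < M)
    (x₀ n : E2) (hx₀ : x₀ ∈ frontier Ω) (hreg : RegularPt Ω x₀)
    (hn : IsSupportNormal Ω x₀ n)
    (u : E2 → ℝ) (hu : ConcaveOn ℝ Ω u) (hub : ∀ x ∈ Ω, u x ∈ Icc 0 M)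
    (husc : UpperSemicontinuousOn u Ω)
    (hz : 0 < u x₀)
    (hmax : ∀ x ∈ {y : E2 | ⟪x₀ - y, n⟫ = 0} ∩ frontier Ω, u x ≤ u x₀) :
    (∀ k : ℝ, 0 < k → ∃ βk : ℝ,
      (fun x => ⟪x₀ - x, n⟫) '' Omk Ω u x₀ n k = Icc 0 ((u x₀ + βk) / k) ∧
      βk ≤ sSup (u '' Omk Ω u x₀ n k) - u x₀) ∧
    Tendsto (fun k : ℝ => k * sSup ((fun x => ⟪x₀ - x, n⟫) '' Omk Ω u x₀ n k))
      atTop (𝓝 (u x₀)) := by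
  obtain ⟨hc, hconv, y, hy⟩ := hΩ
  set g : E2 → ℝ := fun x => ⟪x₀ - x, n⟫ with hg
  have hgc : Continuous g := by fun_prop
  have hx₀Ω : x₀ ∈ Ω := hc.isClosed.frontier_subset hx₀
  have hg0 : g x₀ = 0 := by simp [hg]
  have hgnn : ∀ x ∈ Ω, 0 ≤ g x := hn.2
  have hgaff : ∀ (x z : E2) (a b : ℝ), a + b = 1 → g (a • x + b • z) = a * g x + b * g z := by
    intro x z a b hab
    have : x₀ - (a • x + b • z) = a • (x₀ - x) + b • (x₀ - z) := by
      have h : x₀ = (a + b) • x₀ := by rw [hab, one_smul]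
      rw [smul_sub, smul_sub]
      nth_rewrite 1 [h]
      rw [add_smul]; abel
    simp only [hg, this, inner_add_left, real_inner_smul_left]
  have hcomp : ∀ k, IsCompact (Omk Ω u x₀ n k) := fun k =>
    aux_closed Ω hc u (fun x => k * g x) husc (by fun_prop)
  have hmem0 : ∀ k, x₀ ∈ Omk Ω u x₀ n k := by
    intro k
    refine ⟨hx₀Ω, ?_⟩
    change k * g x₀ ≤ u x₀
    rw [hg0]; linarith
  have hcvx : ∀ k, Convex ℝ (Omk Ω u x₀ n k) := by
    intro k x hx z hz a b ha hb hab
    refine ⟨hconv hx.1 hz.1 ha hb hab, ?_⟩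
    have h1 := hu.2 hx.1 hz.1 ha hb hab
    have hx2 : k * g x ≤ u x := hx.2
    have hz2 : k * g z ≤ u z := hz.2
    change k * g (a • x + b • z) ≤ _
    rw [hgaff x z a b hab]
    simp only [smul_eq_mul] at h1
    nlinarith [mul_le_mul_of_nonneg_left hx2 ha, mul_le_mul_of_nonneg_left hz2 hb]
  -- the maximiser
  have hbdd : ∀ k, BddAbove (g '' Omk Ω u x₀ n k) := fun k => ((hcomp k).image hgc).bddAbove
  have hmaxi : ∀ k, ∃ x ∈ Omk Ω u x₀ n k, g x = sSup (g '' Omk Ω u x₀ n k) := by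
    intro k
    exact ((hcomp k).image hgc).sSup_mem ⟨_, mem_image_of_mem g (hmem0 k)⟩
  constructor
  · intro k hk
    refine ⟨k * sSup (g '' Omk Ω u x₀ n k) - u x₀, ?_, ?_⟩
    · have e : (u x₀ + (k * sSup (g '' Omk Ω u x₀ n k) - u x₀)) / k
          = sSup (g '' Omk Ω u x₀ n k) := by field_simp; ring
      rw [e]
      apply Subset.antisymm
      · rintro _ ⟨x, hx, rfl⟩
        exact ⟨hgnn x hx.1, le_csSup (hbdd k) (mem_image_of_mem g hx)⟩
      · obtain ⟨x, hx, hxe⟩ := hmaxi k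
        rw [← hxe]
        have hp : IsPreconnected (g '' Omk Ω u x₀ n k) :=
          (hcvx k).isPreconnected.image g hgc.continuousOn
        exact hp.Icc_subset ⟨x₀, hmem0 k, hg0⟩ ⟨x, hx, rfl⟩
    · obtain ⟨x, hx, hxe⟩ := hmaxi k
      rw [← hxe]
      have hb : BddAbove (u '' Omk Ω u x₀ n k) :=
        ⟨M, by rintro _ ⟨z, hz, rfl⟩; exact (hub z hz.1).2⟩
      have h1 : u x ≤ sSup (u '' Omk Ω u x₀ n k) := le_csSup hb (mem_image_of_mem u hx)
      have h2 : k * g x ≤ u x := hx.2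
      linarith
  · have hc0 : 0 < g y := aux_interior Ω x₀ n hn y hy
    have hyΩ : y ∈ Ω := interior_subset hy
    have hlow : ∀ k : ℝ, 0 < k →
        u x₀ - u x₀ * (u x₀ / (k * g y + u x₀)) ≤ k * sSup (g '' Omk Ω u x₀ n k) := by
      intro k hk
      have hd : 0 < k * g y + u x₀ := by positivity
      set t := u x₀ / (k * g y + u x₀) with ht
      have ht0 : 0 ≤ t := by positivity
      have ht1 : t ≤ 1 := by
        rw [ht, div_le_one hd]; nlinarith [mul_pos hk hc0]
      have hte : t * (k * g y + u x₀) = u x₀ := by rw [ht]; field_simp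
      have hgz := hgaff x₀ y (1 - t) t (by ring)
      have huz := hu.2 hx₀Ω hyΩ (by linarith : 0 ≤ 1 - t) ht0 (by ring)
      have hzΩ := hconv hx₀Ω hyΩ (by linarith : 0 ≤ 1 - t) ht0 (by ring)
      simp only [smul_eq_mul] at huz
      have hty := mul_nonneg ht0 (hub y hyΩ).1
      rw [hg0] at hgz
      have hzm : (1 - t) • x₀ + t • y ∈ Omk Ω u x₀ n k := by
        refine ⟨hzΩ, ?_⟩
        change k * g _ ≤ _
        rw [hgz]
        nlinarith
      have h1 := mul_le_mul_of_nonneg_left (le_csSup (hbdd k) (mem_image_of_mem g hzm)) hk.le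
      rw [hgz] at h1
      nlinarith
    have hlim : Tendsto (fun k : ℝ => u x₀ - u x₀ * (u x₀ / (k * g y + u x₀))) atTop
        (𝓝 (u x₀)) := by
      have h1 : Tendsto (fun k : ℝ => k * g y + u x₀) atTop atTop :=
        tendsto_atTop_add_const_right _ _ (tendsto_id.atTop_mul_const hc0)
      have h2 := (h1.const_div_atTop (u x₀)).const_mul (u x₀)
      simpa using h2.const_sub (u x₀)
    rw [tendsto_order]
    constructor
    · intro a ha
      filter_upwards [hlim.eventually (lt_mem_nhds ha), eventually_gt_atTop 0] with k h1 h2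
      exact h1.trans_le (hlow k h2)
    · intro a ha
      have hA : IsCompact {x ∈ Ω | a ≤ u x} :=
        aux_closed Ω hc u (fun _ => a) husc continuous_const
      have hpos : ∀ x ∈ {x ∈ Ω | a ≤ u x}, 0 < g x := by
        rintro x ⟨hx, hxa⟩
        refine lt_of_le_of_ne (hgnn x hx) fun h => ?_
        have hfr : x ∈ frontier Ω := by
          rw [hc.isClosed.frontier_eq]
          refine ⟨hx, fun hi => ?_⟩
          have : 0 < g x := aux_interior Ω x₀ n hn x hi
          linarith
        have := hmax x ⟨h.symm, hfr⟩
        linarith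
      obtain ⟨m, hm, hmA⟩ : ∃ m : ℝ, 0 < m ∧ ∀ x ∈ {x ∈ Ω | a ≤ u x}, m ≤ g x := by
        rcases Set.eq_empty_or_nonempty {x ∈ Ω | a ≤ u x} with he | hne
        · exact ⟨1, one_pos, by rw [he]; simp⟩
        · obtain ⟨x, hx, hxm⟩ := hA.exists_isMinOn hne hgc.continuousOn
          exact ⟨g x, hpos x hx, fun z hz => hxm hz⟩
      filter_upwards [eventually_gt_atTop (M / m), eventually_gt_atTop 0] with k hk hk0
      obtain ⟨x, hx, hxe⟩ := hmaxi k
      rw [← hxe]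
      have h2 : k * g x ≤ u x := hx.2
      refine h2.trans_lt ?_
      by_contra! hcon
      have h3 := hmA x ⟨hx.1, hcon⟩
      have h4 := (hub x hx.1).2
      rw [div_lt_iff₀ hm] at hk
      nlinarith [mul_le_mul_of_nonneg_left h3 hk0.le]
end
end

section
/- Let Ω ⊂ ℝ² be a convex body and let A ∈ ∂Ω be a regular point, with (unique) supporting line l and outward unit normal n at A. Let e be a unit vector orthogonal to n such that ⟨x − A, e⟩ ≤ 0 for every x ∈ l ∩ Ω (i.e., A is the endpoint of the segment l ∩ Ω in the direction e). Define h(t) = sup{⟨x − A, e⟩ : x ∈ Ω, ⟨A − x, n⟩ ≤ t} for t > 0. Then h(t)/t → +∞ as t → 0⁺. -/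
noncomputable section

open MeasureTheory Set Filter
open scoped RealInnerProductSpace Topology

/-- At a regular boundary point `A` of a convex body, which is the endpoint of
the segment `l ∩ Ω` in the direction `e` (a unit vector orthogonal to the
outward normal `n`), the horizontal extent
`h(t) = sup{⟨x − A, e⟩ : x ∈ Ω, ⟨A − x, n⟩ ≤ t}` satisfies `h(t)/t → +∞`
as `t → 0⁺`. -/
theorem extent_superlinear_at_regular_point
    (Ω : Set E2) (hΩ : IsConvexBody Ω) (A n e : E2)
    (hA : A ∈ frontier Ω) (hreg : RegularPt Ω A) (hn : IsSupportNormal Ω A n)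
    (he : ‖e‖ = 1) (hperp : ⟪n, e⟫ = 0)
    (hend : ∀ x ∈ {y : E2 | ⟪A - y, n⟫ = 0} ∩ Ω, ⟪x - A, e⟫ ≤ 0) :
    Tendsto
      (fun t : ℝ => sSup {r : ℝ | ∃ x ∈ Ω, ⟪A - x, n⟫ ≤ t ∧ ⟪x - A, e⟫ = r} / t)
      (𝓝[>] 0) atTop := by
  obtain ⟨hcomp, hconv, -⟩ := hΩ
  have hAΩ : A ∈ Ω := hcomp.isClosed.frontier_subset hA
  rw [tendsto_atTop]
  intro K₀
  obtain ⟨K, hK, hK₀⟩ : ∃ K : ℝ, 0 < K ∧ K₀ ≤ K :=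
    ⟨max K₀ 1, lt_of_lt_of_le one_pos (le_max_right _ _), le_max_left _ _⟩
  have hee : ⟪e, e⟫ = (1 : ℝ) := by rw [real_inner_self_eq_norm_sq, he]; norm_num
  -- a point of the body strictly beyond the line of slope `K`
  obtain ⟨x₀, hx₀, hlt⟩ : ∃ x ∈ Ω, K * ⟪A - x, n⟫ < ⟪x - A, e⟫ := by
    by_contra! hcon
    have hw : K • n + e ≠ 0 := by
      intro h
      have h1 : ⟪K • n + e, e⟫ = (0 : ℝ) := by rw [h, inner_zero_left]
      rw [inner_add_left, real_inner_smul_left, hperp, hee] at h1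
      norm_num at h1
    have hpos : 0 < ‖K • n + e‖ := norm_pos_iff.mpr hw
    have hsup : IsSupportNormal Ω A (‖K • n + e‖⁻¹ • (K • n + e)) := by
      refine ⟨?_, fun x hx => ?_⟩
      · rw [norm_smul, norm_inv, norm_norm, inv_mul_cancel₀ hpos.ne']
      · rw [real_inner_smul_right, inner_add_right, real_inner_smul_right]
        have h1 := hcon x hx
        have h2 : ⟪A - x, e⟫ = -⟪x - A, e⟫ := by rw [← inner_neg_left, neg_sub]
        rw [h2]
        exact mul_nonneg (inv_nonneg.mpr hpos.le) (by linarith)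
    have heq := hreg.unique hsup hn
    have h3 : ⟪‖K • n + e‖⁻¹ • (K • n + e), e⟫ = (0 : ℝ) := by rw [heq, hperp]
    rw [real_inner_smul_left, inner_add_left, real_inner_smul_left, hperp, hee] at h3
    have := inv_pos.mpr hpos
    linarith
  have hs : 0 < ⟪A - x₀, n⟫ := by
    rcases (hn.2 x₀ hx₀).lt_or_eq with h | h
    · exact h
    · have h1 := hend x₀ ⟨h.symm, hx₀⟩
      rw [← h] at hlt
      linarith
  filter_upwards [Ioo_mem_nhdsGT hs] with t ht
  obtain ⟨ht0, hts⟩ := ht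
  rw [le_div_iff₀ ht0]
  have hbdd : BddAbove {r : ℝ | ∃ x ∈ Ω, ⟪A - x, n⟫ ≤ t ∧ ⟪x - A, e⟫ = r} := by
    have hc : ContinuousOn (fun x : E2 => ⟪x - A, e⟫) Ω := by fun_prop
    refine (hcomp.bddAbove_image hc).mono ?_
    rintro r ⟨x, hx, -, rfl⟩
    exact ⟨x, hx, rfl⟩
  set s := ⟪A - x₀, n⟫ with hsdef
  have hc0 : 0 ≤ t / s := (div_pos ht0 hs).le
  have hc1 : t / s ≤ 1 := (div_le_one hs).mpr hts.le
  have hmem : A + (t / s) • (x₀ - A) ∈ Ω := hconv.add_smul_sub_mem hAΩ hx₀ ⟨hc0, hc1⟩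
  have hle : t / s * ⟪x₀ - A, e⟫ ≤
      sSup {r : ℝ | ∃ x ∈ Ω, ⟪A - x, n⟫ ≤ t ∧ ⟪x - A, e⟫ = r} := by
    refine le_csSup hbdd ⟨_, hmem, ?_, ?_⟩
    · have h1 : A - (A + (t / s) • (x₀ - A)) = (t / s) • (A - x₀) := by module
      rw [h1, real_inner_smul_left, ← hsdef, div_mul_cancel₀ _ hs.ne']
    · rw [add_sub_cancel_left, real_inner_smul_left]
  calc K₀ * t ≤ K * t := mul_le_mul_of_nonneg_right hK₀ ht0.le
    _ = t / s * (K * s) := by field_simp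
    _ ≤ t / s * ⟪x₀ - A, e⟫ := mul_le_mul_of_nonneg_left hlt.le hc0
    _ ≤ _ := hle
end
end

section
/- Let K ⊂ ℝ² be a compact convex set, e a unit vector, and h > 0, such that K ⊆ {x : 0 ≤ ⟨x, e⟩ ≤ h} and K ∩ {x : ⟨x, e⟩ = h} ≠ ∅. Then for every s with 0 < s < h, the area of K satisfies |K| ≤ (h/(h − s))² · |K ∩ {x : ⟨x, e⟩ ≥ s}|. -/
noncomputable section

open MeasureTheory Set Filter
open scoped RealInnerProductSpace Topology

/-- If a compact convex `K ⊂ ℝ²` lies in the band `0 ≤ ⟨x, e⟩ ≤ h` and touches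
the line `⟨x, e⟩ = h`, then for `0 < s < h` its area satisfies
`|K| ≤ (h/(h−s))² · |K ∩ {⟨x, e⟩ ≥ s}|`. -/
theorem area_band_estimate
    (K : Set E2) (hne : K.Nonempty) (hKc : IsCompact K) (hKconv : Convex ℝ K)
    (e : E2) (he : ‖e‖ = 1) (h : ℝ) (hh : 0 < h)
    (hband : K ⊆ {x : E2 | 0 ≤ ⟪x, e⟫ ∧ ⟪x, e⟫ ≤ h})
    (htouch : (K ∩ {x : E2 | ⟪x, e⟫ = h}).Nonempty)
    (s : ℝ) (hs : 0 < s) (hsh : s < h) :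
    (volume K).toReal ≤
      (h / (h - s)) ^ 2 * (volume (K ∩ {x : E2 | s ≤ ⟪x, e⟫})).toReal := by
  obtain ⟨p, hpK, hp⟩ := htouch
  have hp' : ⟪p, e⟫ = h := hp
  have hd : 0 < h - s := sub_pos.mpr hsh
  set r : ℝ := (h - s) / h with hr
  have hr0 : 0 < r := div_pos hd hh
  have hr1 : r ≤ 1 := by rw [hr, div_le_one hh]; linarith
  have hrh : r * h = h - s := by rw [hr]; field_simp
  have hsub : AffineMap.homothety p r '' K ⊆ K ∩ {x : E2 | s ≤ ⟪x, e⟫} := by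
    rintro _ ⟨x, hx, rfl⟩
    have hx0 : 0 ≤ ⟪x, e⟫ := (hband hx).1
    refine ⟨?_, ?_⟩
    · rw [AffineMap.homothety_eq_lineMap]
      exact hKconv.lineMap_mem hpK hx ⟨hr0.le, hr1⟩
    · simp only [mem_setOf_eq, AffineMap.homothety_apply, vsub_eq_sub, vadd_eq_add,
        inner_add_left, real_inner_smul_left, inner_sub_left, hp']
      nlinarith [mul_nonneg hr0.le hx0]
  have hfin : volume (K ∩ {x : E2 | s ≤ ⟪x, e⟫}) ≠ ⊤ :=
    ((measure_mono inter_subset_left).trans_lt hKc.measure_lt_top).ne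
  have hm := ENNReal.toReal_mono hfin (measure_mono (μ := volume) hsub)
  rw [Measure.addHaar_image_homothety, ENNReal.toReal_mul, finrank_euclideanSpace_fin,
    ENNReal.toReal_ofReal (abs_nonneg _), abs_of_nonneg (sq_nonneg r)] at hm
  have hinv : (h / (h - s)) ^ 2 * r ^ 2 = 1 := by
    rw [hr]; field_simp
  calc (volume K).toReal = (h / (h - s)) ^ 2 * (r ^ 2 * (volume K).toReal) := by
        rw [← mul_assoc, hinv, one_mul]
    _ ≤ _ := mul_le_mul_of_nonneg_left hm (sq_nonneg _)
end
end
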